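/- arXiv:1902.05593 — 2 statements merged into one kernel-verified Lean document; each statement's English description precedes it below -/
import Mathlib

section
/- There exist a constant c > 1 and n₀ ∈ ℕ such that every real Banach space X of finite dimension n ≥ n₀ satisfies H'_α(X) ≥ c^n; that is, X contains a set of at least c^n points on its unit sphere that is a bounded and separated antipodal set with some constant d > 1. Hence the strict antipodal Hadwiger number increases exponentially in the dimension. -/
open Metric

noncomputable section

/-- `S` is a bounded and separated antipodal subset of `X` with constant `d`. -/
def IsBSA {X : Type*} [NormedAddCommGroup X] [NormedSpace ℝ X] (S : Set X) (d : ℝ) : Prop :=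
  S ⊆ closedBall (0 : X) 1 ∧
    ∀ x ∈ S, ∀ y ∈ S, x ≠ y → ∃ f : X →L[ℝ] ℝ, ‖f‖ ≤ 1 ∧
      d ≤ f x - f y ∧ ∀ z ∈ S, f y ≤ f z ∧ f z ≤ f x

/-- The strict antipodality condition (with gap `> 1`). -/
def StrictAntipProp {X : Type*} [NormedAddCommGroup X] [NormedSpace ℝ X] (S : Set X) : Prop :=
  ∀ x ∈ S, ∀ y ∈ S, x ≠ y → ∃ f : X →L[ℝ] ℝ, ‖f‖ ≤ 1 ∧
    1 < f x - f y ∧ ∀ z ∈ S, f y ≤ f z ∧ f z ≤ f x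

/-- The strict antipodal Hadwiger number `H'_α(X)`. -/
def strictHalpha (X : Type*) [NormedAddCommGroup X] [NormedSpace ℝ X] : ℕ :=
  sSup {k : ℕ | ∃ S : Finset X, S.card = k ∧ (S : Set X) ⊆ sphere (0 : X) 1 ∧
    StrictAntipProp (S : Set X)}

section PA

abbrev VV (n : ℕ) := EuclideanSpace ℝ (Fin n)

def sg (b : Bool) : ℝ := if b then 1 else -1

lemma sg_true : sg true = 1 := rfl
lemma sg_false : sg false = -1 := by simp [sg]
lemma sg_sq (b : Bool) : sg b * sg b = 1 := by cases b <;> simp [sg]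
lemma sg_abs (b : Bool) : |sg b| = 1 := by cases b <;> simp [sg]

/-- average over signs -/
def Ex {n : ℕ} (h : (Fin n → Bool) → ℝ) : ℝ := (∑ ε, h ε) / 2 ^ n

lemma Ex_mono {n : ℕ} {h g : (Fin n → Bool) → ℝ} (H : ∀ ε, h ε ≤ g ε) : Ex h ≤ Ex g := by
  unfold Ex
  gcongr with ε
  exact H ε

lemma Ex_const {n : ℕ} (c : ℝ) : Ex (fun _ : Fin n → Bool => c) = c := by
  unfold Ex
  simp

lemma Ex_add {n : ℕ} (h g : (Fin n → Bool) → ℝ) : Ex (fun ε => h ε + g ε) = Ex h + Ex g := by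
  unfold Ex
  rw [Finset.sum_add_distrib, add_div]

lemma Ex_mul {n : ℕ} (c : ℝ) (h : (Fin n → Bool) → ℝ) : Ex (fun ε => c * h ε) = c * Ex h := by
  unfold Ex
  rw [← Finset.mul_sum, mul_div_assoc]

lemma Ex_sub {n : ℕ} (h g : (Fin n → Bool) → ℝ) : Ex (fun ε => h ε - g ε) = Ex h - Ex g := by
  unfold Ex
  rw [Finset.sum_sub_distrib, sub_div]

lemma Ex_sum {n : ℕ} {ι : Type*} (s : Finset ι) (h : ι → (Fin n → Bool) → ℝ) :
    Ex (fun ε => ∑ i ∈ s, h i ε) = ∑ i ∈ s, Ex (h i) := by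
  unfold Ex
  rw [Finset.sum_comm, Finset.sum_div]

lemma Ex_nonneg {n : ℕ} {h : (Fin n → Bool) → ℝ} (H : ∀ ε, 0 ≤ h ε) : 0 ≤ Ex h := by
  unfold Ex
  exact div_nonneg (Finset.sum_nonneg fun i _ => H i) (by positivity)

lemma sum_bool_succ {n : ℕ} {M : Type*} [AddCommMonoid M] (h : (Fin (n+1) → Bool) → M) :
    ∑ ε, h ε = ∑ ε, h (Fin.cons true ε) + ∑ ε, h (Fin.cons false ε) := by
  rw [← (Fin.consEquiv (fun _ => Bool)).sum_comp, Fintype.sum_prod_type]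
  simp [Fin.consEquiv]

lemma Ex_succ {n : ℕ} (h : (Fin (n+1) → Bool) → ℝ) :
    Ex h = (Ex (fun ε => h (Fin.cons true ε)) + Ex (fun ε => h (Fin.cons false ε))) / 2 := by
  unfold Ex
  rw [sum_bool_succ]
  field_simp
  ring

lemma quarter_sum {ι : Type*} (t : Finset ι) (g : ι → ℕ) (hg : Set.InjOn g t) :
    ∑ a ∈ t, (1/4:ℝ) ^ (g a) ≤ 4/3 := by
  classical
  rw [← Finset.sum_image (f := fun j => (1/4:ℝ)^j) hg]
  have h := tsum_geometric_of_lt_one (r := (1/4:ℝ)) (by norm_num) (by norm_num)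
  have h2 := (summable_geometric_of_lt_one (r := (1/4:ℝ)) (by norm_num) (by norm_num)).sum_le_tsum
    (t.image g) (fun i _ => by positivity)
  rw [h] at h2
  refine h2.trans (by norm_num)

lemma four_rpow_neg_le {y : ℝ} {k : ℕ} (h : (k:ℝ) ≤ y) : (4:ℝ) ^ (-y) ≤ (1/4) ^ k := by
  have : ((1:ℝ)/4)^k = (4:ℝ) ^ (-(k:ℝ)) := by
    rw [Real.rpow_neg (by norm_num), Real.rpow_natCast]; simp
  rw [this]
  exact Real.rpow_le_rpow_of_exponent_le (by norm_num) (by linarith)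

lemma four_rpow_abs_sum (x : ℝ) (s : Finset ℤ) : ∑ a ∈ s, (4:ℝ) ^ (-|(a:ℝ) - x|) ≤ 3 := by
  classical
  rw [← Finset.sum_filter_add_sum_filter_not s (fun a => a ≤ ⌊x⌋)]
  have hx := Int.floor_le x
  have hx' := Int.lt_floor_add_one x
  have h1 : ∑ a ∈ s.filter (fun a => a ≤ ⌊x⌋), (4:ℝ) ^ (-|(a:ℝ) - x|) ≤ 4/3 := by
    refine le_trans ?_ (quarter_sum (s.filter (fun a => a ≤ ⌊x⌋)) (fun a => (⌊x⌋ - a).toNat) ?_)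
    · apply Finset.sum_le_sum
      intro a ha
      simp at ha
      apply four_rpow_neg_le
      have h3 : (((⌊x⌋ - a).toNat : ℤ) : ℝ) = (⌊x⌋ : ℝ) - a := by
        rw [Int.toNat_of_nonneg (by omega)]; push_cast; ring
      rw [Int.cast_natCast] at h3
      rw [h3, abs_sub_comm]
      refine le_trans ?_ (le_abs_self _)
      linarith
    · intro a ha b hb hab
      simp at ha hb hab
      omega
  have h2 : ∑ a ∈ s.filter (fun a => ¬ a ≤ ⌊x⌋), (4:ℝ) ^ (-|(a:ℝ) - x|) ≤ 4/3 := by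
    refine le_trans ?_ (quarter_sum (s.filter (fun a => ¬ a ≤ ⌊x⌋)) (fun a => (a - ⌊x⌋ - 1).toNat) ?_)
    · apply Finset.sum_le_sum
      intro a ha
      simp at ha
      apply four_rpow_neg_le
      have h3 : (((a - ⌊x⌋ - 1).toNat : ℤ) : ℝ) = (a : ℝ) - ⌊x⌋ - 1 := by
        rw [Int.toNat_of_nonneg (by have := ha.2; rw [Int.floor_lt] at *; have := Int.floor_lt.2 ha.2; omega)]; push_cast; ring
      rw [Int.cast_natCast] at h3
      rw [h3]
      refine le_trans ?_ (le_abs_self _)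
      linarith
    · intro a ha b hb hab
      simp only [Finset.coe_filter, Set.mem_setOf_eq] at ha hb
      simp only at hab
      omega
  linarith

lemma counting : ∀ (n : ℕ) (G : Finset (Fin n → ℤ)) (h : (Fin n → Bool) → ℝ)
    (_ : ∀ z ∈ G, ∀ ε, ∑ i, (z i : ℝ) * sg (ε i) ≤ h ε),
    (G.card : ℝ) ≤ 3 ^ n * (4:ℝ) ^ (Ex h) := by
  intro n
  induction n with
  | zero =>
    intro G h H
    rcases G.eq_empty_or_nonempty with rfl | ⟨z, hz⟩
    · simp; positivity
    · have h1 : (G.card : ℝ) ≤ 1 := by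
        have := Finset.card_le_one_of_subsingleton G
        exact_mod_cast this
      have h2 : 0 ≤ Ex h := Ex_nonneg (fun ε => by simpa using H z hz ε)
      have := Real.one_le_rpow (x := 4) (by norm_num) h2
      simp; linarith
  | succ n ih =>
    intro G h H
    classical
    set P := Ex (fun ε => h (Fin.cons true ε))
    set Q := Ex (fun ε => h (Fin.cons false ε))
    have key : ∀ a : ℤ, (((G.filter (fun z => z 0 = a)).card : ℕ) : ℝ) ≤
        3 ^ n * ((4:ℝ) ^ (Ex h) * (4:ℝ) ^ (-|(a:ℝ) - (P - Q)/2|)) := by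
      intro a
      set Ga := (G.filter (fun z => z 0 = a)).image Fin.tail with hGa
      have hcard : Ga.card = (G.filter (fun z => z 0 = a)).card := by
        apply Finset.card_image_of_injOn
        intro z hz w hw e
        simp at hz hw
        rw [← Fin.cons_self_tail z, ← Fin.cons_self_tail w, e, hz.2, hw.2]
      rw [← hcard]
      have h1 := ih Ga (fun ε => h (Fin.cons true ε) - a) (by
        intro z hz ε
        simp [hGa] at hz
        obtain ⟨w, ⟨hw, rfl⟩, rfl⟩ := hz
        have := H w hw (Fin.cons true ε)
        rw [Fin.sum_univ_succ] at this
        simp [sg_true] at this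
        simp [Fin.tail]
        linarith)
      have h2 := ih Ga (fun ε => h (Fin.cons false ε) + a) (by
        intro z hz ε
        simp [hGa] at hz
        obtain ⟨w, ⟨hw, rfl⟩, rfl⟩ := hz
        have := H w hw (Fin.cons false ε)
        rw [Fin.sum_univ_succ] at this
        simp [sg_false] at this
        simp [Fin.tail]
        linarith)
      rw [Ex_sub, Ex_const] at h1
      rw [Ex_add, Ex_const] at h2
      rw [← Real.rpow_add (by norm_num)]
      have he : Ex h = (P + Q) / 2 := Ex_succ h
      rcases le_total ((P-Q)/2) a with hle | hle
      · rw [abs_of_nonneg (by linarith)]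
        convert h1 using 3
        rw [he]; ring
      · rw [abs_of_nonpos (by linarith)]
        convert h2 using 3
        rw [he]; ring
    set I : Finset ℤ := G.image (fun z => z 0)
    have hc : G.card = ∑ a ∈ I, (G.filter (fun z => z 0 = a)).card :=
      Finset.card_eq_sum_card_image _ _
    rw [hc]
    push_cast
    calc _ ≤ ∑ a ∈ I, 3 ^ n * ((4:ℝ) ^ (Ex h) * (4:ℝ) ^ (-|(a:ℝ) - (P - Q)/2|)) :=
          Finset.sum_le_sum fun a _ => key a
      _ = 3 ^ n * (4:ℝ) ^ (Ex h) * ∑ a ∈ I, (4:ℝ) ^ (-|(a:ℝ) - (P - Q)/2|) := by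
          rw [Finset.mul_sum]; apply Finset.sum_congr rfl; intros; ring
      _ ≤ 3 ^ n * (4:ℝ) ^ (Ex h) * 3 := by
          gcongr
          exact four_rpow_abs_sum _ _
      _ = _ := by ring

end PA

section PB

lemma rounding_aux {H : Type*} [NormedAddCommGroup H] [InnerProductSpace ℝ H] {ι : Type*}
    (s : Finset ι) (a : ι → H) (t : ι → ℝ) :
    ∃ z : ι → ℤ, (∀ j, |(z j : ℝ) - t j| ≤ 1) ∧
      ‖∑ j ∈ s, ((z j : ℝ) - t j) • a j‖ ^ 2 ≤ (1/4) * ∑ j ∈ s, ‖a j‖ ^ 2 := by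
  classical
  induction s using Finset.induction_on with
  | empty =>
    refine ⟨fun j => ⌊t j⌋, fun j => ?_, by simp⟩
    have h1 := Int.floor_le (t j)
    have h2 := Int.lt_floor_add_one (t j)
    rw [abs_le]; constructor <;> linarith
  | insert i s hi ih =>
    obtain ⟨z, hz, hs⟩ := ih
    set w := ∑ j ∈ s, ((z j : ℝ) - t j) • a j
    have h1 := Int.floor_le (t i)
    have h2 := Int.lt_floor_add_one (t i)
    have key : ∃ c : ℤ, |(c : ℝ) - t i| ≤ 1 ∧
        ‖((c:ℝ) - t i) • a i + w‖ ^ 2 ≤ (1/4) * ‖a i‖^2 + ‖w‖^2 := by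
      have ex : ∀ x : ℝ, ‖x • a i + w‖ ^ 2 = x^2 * ‖a i‖^2 + 2 * x * inner ℝ (a i) w + ‖w‖^2 := by
        intro x
        rw [norm_add_sq_real, norm_smul, inner_smul_left]
        simp [mul_pow]
        ring
      by_contra hcon
      push Not at hcon
      have e1 := hcon ⌊t i⌋ (by rw [abs_le]; constructor <;> linarith)
      have e2 := hcon (⌊t i⌋ + 1) (by rw [abs_le]; push_cast; constructor <;> linarith)
      rw [ex] at e1 e2
      push_cast at e1 e2
      set p := t i - ⌊t i⌋ with hp
      have q1 : (⌊t i⌋ : ℝ) - t i = -p := by rw [hp]; ring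
      have q2 : (⌊t i⌋ : ℝ) + 1 - t i = 1 - p := by rw [hp]; ring
      rw [q1] at e1
      rw [q2] at e2
      set I := inner ℝ (a i) w
      have hp0 : 0 ≤ p := by rw [hp]; linarith
      have hp1 : 0 < 1 - p := by rw [hp]; linarith
      have f1 : (1-p) * (1/4 * ‖a i‖^2) < (1-p) * ((-p)^2 * ‖a i‖^2 + 2 * (-p) * I) :=
        mul_lt_mul_of_pos_left (by linarith) hp1
      have f2 : p * (1/4 * ‖a i‖^2) ≤ p * ((1-p)^2 * ‖a i‖^2 + 2 * (1-p) * I) :=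
        mul_le_mul_of_nonneg_left (by linarith) hp0
      nlinarith [mul_nonneg (sq_nonneg (p - 1/2)) (sq_nonneg ‖a i‖)]
    obtain ⟨c, hc, hcs⟩ := key
    refine ⟨Function.update z i c, ?_, ?_⟩
    · intro j
      by_cases hj : j = i
      · subst hj; simpa using hc
      · simpa [Function.update_of_ne hj] using hz j
    · rw [Finset.sum_insert hi, Finset.sum_insert hi]
      have : ∑ j ∈ s, (((Function.update z i c) j : ℝ) - t j) • a j = w := by
        apply Finset.sum_congr rfl
        intro j hj
        rw [Function.update_of_ne (by rintro rfl; exact hi hj)]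
      rw [this]
      simp only [Function.update_self]
      linarith

open MeasureTheory ProbabilityTheory

lemma gauss_exp_integral (v : NNReal) (hv : (1/4:ℝ) ≤ v) (θ : ℝ) (hθ : 0 < θ) :
    ∫ x, Real.exp (-(x^2/θ^2)) ∂(gaussianReal 0 v) ≤ Real.sqrt 2 * θ := by
  have hv0 : v ≠ 0 := by rintro rfl; norm_num at hv
  have hvp : (0:ℝ) < v := by linarith
  rw [integral_gaussianReal_eq_integral_smul hv0]
  simp only [gaussianPDFReal, smul_eq_mul, sub_zero]
  have : ∀ x : ℝ, (√(2 * Real.pi * v))⁻¹ * Real.exp (-x^2 / (2 * v)) * Real.exp (-(x^2/θ^2)) =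
      (√(2 * Real.pi * v))⁻¹ * Real.exp (-(1/(2*v) + 1/θ^2) * x^2) := by
    intro x
    rw [mul_assoc, ← Real.exp_add]
    congr 2
    field_simp
    ring
  simp_rw [this]
  rw [integral_const_mul, integral_gaussian]
  have h1 : √(Real.pi / (1/(2*v) + 1/θ^2)) ≤ √(Real.pi * θ^2) := by
    apply Real.sqrt_le_sqrt
    rw [div_le_iff₀ (by positivity)]
    have : Real.pi * θ^2 * (1/(2*v) + 1/θ^2) = Real.pi * θ^2 * (1/(2*v)) + Real.pi := by
      field_simp
    rw [this]
    have : 0 ≤ Real.pi * θ^2 * (1/(2*v)) := by positivity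
    linarith
  have h2 : √(Real.pi * θ^2) ≤ √(2 * Real.pi * v) * (√2 * θ) := by
    rw [show √2 * θ = √(2 * θ^2) by rw [Real.sqrt_mul (by norm_num), Real.sqrt_sq hθ.le],
      ← Real.sqrt_mul (by positivity)]
    apply Real.sqrt_le_sqrt
    have : 0 ≤ Real.pi * θ^2 := by positivity
    nlinarith
  rw [inv_mul_le_iff₀ (by positivity)]
  exact h1.trans h2

lemma std_exp {n : ℕ} (u : VV n) (hu : 1/2 ≤ ‖u‖) (θ : ℝ) (hθ : 0 < θ) :
    ∫ r, Real.exp (-((inner ℝ r u : ℝ)^2/θ^2)) ∂(stdGaussian (VV n)) ≤ Real.sqrt 2 * θ := by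
  have h := IsGaussian.map_eq_gaussianReal (μ := stdGaussian (VV n)) (innerSL ℝ u)
  rw [integral_strongDual_stdGaussian, variance_dual_stdGaussian] at h
  have h3 := gauss_exp_integral (‖innerSL ℝ u‖^2).toNNReal (by
    rw [Real.coe_toNNReal _ (by positivity), innerSL_apply_norm]; nlinarith) θ hθ
  rw [← h, integral_map (by fun_prop) (by fun_prop)] at h3
  convert h3 using 6
  simp [real_inner_comm]

lemma std_norm (n : ℕ) : Integrable (fun r => ‖r‖^2) (stdGaussian (VV n)) ∧
    ∫ r, ‖r‖^2 ∂(stdGaussian (VV n)) = n := by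
  have hm : ∀ i : Fin n, MemLp (fun r : VV n => r i) 2 (stdGaussian (VV n)) := by
    intro i
    exact IsGaussian.memLp_dual (stdGaussian (VV n)) (EuclideanSpace.proj i) 2 (by simp)
  have hi : ∀ i : Fin n, Integrable (fun r : VV n => (r i)^2) (stdGaussian (VV n)) :=
    fun i => (hm i).integrable_sq
  have he : ∀ r : VV n, ‖r‖^2 = ∑ i, (r i)^2 := fun r => by
    rw [EuclideanSpace.norm_sq_eq]; simp
  simp_rw [he]
  refine ⟨integrable_finsetSum _ (fun i _ => hi i), ?_⟩
  rw [integral_finsetSum _ (fun i _ => hi i)]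
  have : ∀ i : Fin n, ∫ r : VV n, (r i)^2 ∂(stdGaussian (VV n)) = 1 := by
    intro i
    have h1 := variance_dual_stdGaussian (E := VV n) (innerSL ℝ (EuclideanSpace.single i (1:ℝ)))
    have h2 := integral_strongDual_stdGaussian (E := VV n) (innerSL ℝ (EuclideanSpace.single i (1:ℝ)))
    rw [variance_of_integral_eq_zero (by fun_prop) h2, innerSL_apply_norm] at h1
    simpa [EuclideanSpace.inner_single_left] using h1
  simp [this]

lemma one_row {n : ℕ} {ι : Type*} (s : Finset ι) (u : ι → VV n) (hu : ∀ f ∈ s, 1/2 ≤ ‖u f‖)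
    (w : ι → ℝ) (hw : ∀ f ∈ s, 0 < w f) (θ : ℝ) (hθ : 0 < θ) :
    ∃ r : VV n, ‖r‖^2 ≤ 2 * n ∧
      ∑ f ∈ s, w f * Real.exp (-((inner ℝ r (u f) : ℝ)^2/θ^2)) ≤ (∑ f ∈ s, w f) * (3*θ) := by
  rcases s.eq_empty_or_nonempty with rfl | ⟨f0, hf0⟩
  · exact ⟨0, by simp, by simp⟩
  have hn : 0 < n := by
    rcases Nat.eq_zero_or_pos n with rfl | h
    · have := hu f0 hf0
      rw [Subsingleton.elim (u f0) 0] at this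
      norm_num at this
    · exact h
  have hnR : (0:ℝ) < n := by exact_mod_cast hn
  set W := ∑ f ∈ s, w f
  have hW : 0 < W := Finset.sum_pos hw ⟨f0, hf0⟩
  set μ := stdGaussian (VV n)
  have hintg : ∀ f, Integrable (fun r : VV n => Real.exp (-((inner ℝ r (u f) : ℝ)^2/θ^2))) μ := by
    intro f
    apply Integrable.of_bound (C := 1) (by fun_prop)
    filter_upwards with r
    rw [Real.norm_eq_abs, abs_of_pos (Real.exp_pos _), Real.exp_le_one_iff]
    have : 0 ≤ (inner ℝ r (u f) : ℝ)^2/θ^2 := by positivity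
    linarith
  set g : VV n → ℝ := fun r => ∑ f ∈ s, w f * Real.exp (-((inner ℝ r (u f) : ℝ)^2/θ^2))
  have hg : Integrable g μ := integrable_finsetSum _ (fun f _ => (hintg f).const_mul _)
  have hgi : ∫ r, g r ∂μ ≤ W * (√2 * θ) := by
    rw [integral_finsetSum _ (fun f _ => (hintg f).const_mul _), Finset.sum_mul]
    apply Finset.sum_le_sum
    intro f hf
    rw [integral_const_mul]
    exact mul_le_mul_of_nonneg_left (std_exp (u f) (hu f hf) θ hθ) (hw f hf).le
  obtain ⟨hN, hNi⟩ := std_norm n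
  set B := W * (√2 * θ) with hBdef
  have hB : 0 < B := by positivity
  set G : VV n → ℝ := fun r => g r / B + ‖r‖^2 / n
  have hGi : Integrable G μ := (hg.div_const _).add (hN.div_const _)
  obtain ⟨r, hr⟩ := exists_le_integral hGi
  have hle : ∫ r, G r ∂μ ≤ 2 := by
    change ∫ r, (g r / B + ‖r‖^2 / n) ∂μ ≤ 2
    rw [integral_add (hg.div_const _) (hN.div_const _), integral_div, integral_div, hNi, div_self hnR.ne']
    have : (∫ r, g r ∂μ) / B ≤ 1 := by rw [div_le_one hB]; exact hgi
    linarith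
  have hG : g r / B + ‖r‖^2 / n ≤ 2 := hr.trans hle
  have hg0 : 0 ≤ g r := Finset.sum_nonneg fun f hf => mul_nonneg (hw f hf).le (Real.exp_pos _).le
  refine ⟨r, ?_, ?_⟩
  · have h1 : ‖r‖^2 / n ≤ 2 := by
      have : 0 ≤ g r / B := by positivity
      linarith
    rwa [div_le_iff₀ hnR] at h1
  · have h1 : g r / B ≤ 2 := by
      have : 0 ≤ ‖r‖^2 / n := by positivity
      linarith
    rw [div_le_iff₀ hB] at h1
    refine h1.trans ?_
    have : √2 ≤ 3/2 := by rw [Real.sqrt_le_left (by norm_num)]; norm_num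
    rw [hBdef]
    have : W * θ * √2 ≤ W * θ * (3/2) := mul_le_mul_of_nonneg_left this (by positivity)
    nlinarith

lemma rows {n : ℕ} {ι : Type*} (s : Finset ι) (u : ι → VV n) (hu : ∀ f ∈ s, 1/2 ≤ ‖u f‖)
    (θ : ℝ) (hθ : 0 < θ) (k : ℕ) :
    ∃ r : Fin k → VV n, (∀ j, ‖r j‖^2 ≤ 2 * n) ∧
      ∑ f ∈ s, Real.exp (-∑ j, ((inner ℝ (r j) (u f) : ℝ)^2/θ^2)) ≤ s.card * (3*θ)^k := by
  induction k with
  | zero => exact ⟨fun _ => 0, by simp, by simp⟩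
  | succ k ih =>
    obtain ⟨r, hr, hs⟩ := ih
    obtain ⟨r0, hr0, hs0⟩ := one_row s u hu
      (fun f => Real.exp (-∑ j, ((inner ℝ (r j) (u f) : ℝ)^2/θ^2))) (fun f _ => Real.exp_pos _) θ hθ
    refine ⟨Fin.cons r0 r, ?_, ?_⟩
    · intro j
      refine Fin.cases ?_ ?_ j
      · simpa using hr0
      · intro j; simpa using hr j
    · calc _ = ∑ f ∈ s, Real.exp (-∑ j, ((inner ℝ (r j) (u f) : ℝ)^2/θ^2)) *
            Real.exp (-((inner ℝ r0 (u f) : ℝ)^2/θ^2)) := by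
            apply Finset.sum_congr rfl
            intro f _
            rw [← Real.exp_add, Fin.sum_univ_succ]
            congr 1
            simp
        _ ≤ _ := hs0
        _ ≤ s.card * (3*θ)^k * (3*θ) := by gcongr
        _ = _ := by ring

end PB

section PC

def sv {n : ℕ} (ε : Fin n → Bool) : VV n := WithLp.toLp 2 (fun i => sg (ε i))

lemma sv_apply {n : ℕ} (ε : Fin n → Bool) (i : Fin n) : sv ε i = sg (ε i) := rfl

lemma inner_sv {n : ℕ} (v : VV n) (ε : Fin n → Bool) :
    (inner ℝ v (sv ε) : ℝ) = ∑ i, v i * sg (ε i) := by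
  simp [PiLp.inner_apply, sv_apply, mul_comm]

lemma sg_not (b : Bool) : sg (!b) = - sg b := by cases b <;> simp [sg]

lemma sv_not {n : ℕ} (ε : Fin n → Bool) : sv (fun i => !(ε i)) = - sv ε := by
  ext i
  simp [sv_apply, sg_not]

lemma sub_codim {n k : ℕ} (E0 : Submodule ℝ (VV n)) (r : Fin k → VV n) :
    ∃ F : Submodule ℝ (VV n), F ≤ E0 ∧ Module.finrank ℝ E0 ≤ Module.finrank ℝ F + k ∧
      ∀ x ∈ F, ∀ j, (inner ℝ (r j) x : ℝ) = 0 := by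
  let L : E0 →ₗ[ℝ] (Fin k → ℝ) := LinearMap.pi (fun j => (innerSL ℝ (r j)).toLinearMap ∘ₗ E0.subtype)
  refine ⟨(LinearMap.ker L).map E0.subtype, Submodule.map_subtype_le _ _, ?_, ?_⟩
  · rw [LinearEquiv.finrank_eq (Submodule.equivSubtypeMap E0 (LinearMap.ker L)).symm]
    have h := LinearMap.finrank_range_add_finrank_ker L
    have h2 := Submodule.finrank_le (LinearMap.range L)
    rw [Module.finrank_fin_fun] at h2
    omega
  · rintro x ⟨y, hy, rfl⟩ j
    have : L y j = 0 := by rw [LinearMap.mem_ker.1 hy]; rfl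
    exact this

lemma grid_finite {n : ℕ} (b : (Fin n → Bool) → ℝ) (hb : Ex b ≤ 2) (Q : (Fin n → ℤ) → Prop) :
    ∃ G : Finset (Fin n → ℤ), (G.card : ℝ) ≤ 768 ^ n ∧ ∀ z, z ∈ G ↔
      ((∀ ε, ∑ i, (z i : ℝ) * sg (ε i) ≤ 2 * n * b ε) ∧ Q z) := by
  classical
  set S : Set (Fin n → ℤ) := {z | (∀ ε, ∑ i, (z i : ℝ) * sg (ε i) ≤ 2 * n * b ε) ∧ Q z} with hS
  have key : ∀ G : Finset (Fin n → ℤ), (G : Set _) ⊆ S → (G.card : ℝ) ≤ 768 ^ n := by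
    intro G hG
    have h := counting n G (fun ε => 2 * n * b ε) (fun z hz ε => (hG hz).1 ε)
    rw [Ex_mul] at h
    refine h.trans ?_
    have h2 : (4:ℝ) ^ (2 * n * Ex b) ≤ 4 ^ ((4 * n : ℕ) : ℝ) := by
      apply Real.rpow_le_rpow_of_exponent_le (by norm_num)
      push_cast
      have : (0:ℝ) ≤ n := by positivity
      nlinarith
    rw [Real.rpow_natCast, pow_mul] at h2
    calc _ ≤ (3:ℝ)^n * (4^4)^n := by gcongr
      _ = _ := by rw [← mul_pow]; norm_num
  have hfin : S.Finite := by
    by_contra hinf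
    obtain ⟨t, ht, hc⟩ := (Set.not_finite.1 hinf : S.Infinite).exists_subset_card_eq (768^n+1)
    have := key t ht
    rw [hc] at this
    push_cast at this
    linarith
  refine ⟨hfin.toFinset, key _ (by simp), fun z => by simp [hS]⟩

lemma lemP {n k : ℕ} (b : (Fin n → Bool) → ℝ) (hb1 : ∀ ε, 1 ≤ b ε) (hb : Ex b ≤ 2)
    (E0 : Submodule ℝ (VV n)) (θ : ℝ) (hθ : 0 < θ) (hθ2 : θ ≤ 1/2)
    (hsmall : 768 ^ n * (3 * θ) ^ k < Real.exp (-(k/2))) :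
    ∃ F : Submodule ℝ (VV n), F ≤ E0 ∧ Module.finrank ℝ E0 ≤ Module.finrank ℝ F + k ∧
      ∀ v : VV n, E0.starProjection v ∈ F → ∀ s : ℝ, (∀ ε, (inner ℝ v (sv ε) : ℝ) ≤ s * b ε) →
        θ * √n * ‖E0.starProjection v‖ ≤ s := by
  classical
  set P := E0.starProjection with hP
  set δ : ℝ := θ / √n with hδ
  obtain ⟨G, hGc, hG⟩ := grid_finite b hb
    (fun z => 1/2 ≤ ‖P (δ • (WithLp.toLp 2 (fun i => (z i : ℝ)) : VV n))‖)
  obtain ⟨r, hr, hrs⟩ := rows G (fun z => P (δ • (WithLp.toLp 2 (fun i => (z i : ℝ)) : VV n)))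
    (fun z hz => ((hG z).1 hz).2) θ hθ k
  obtain ⟨F, hF, hFd, hFr⟩ := sub_codim E0 r
  refine ⟨F, hF, hFd, ?_⟩
  have spos : ∀ v : VV n, ∀ s : ℝ, (∀ ε, (inner ℝ v (sv ε) : ℝ) ≤ s * b ε) → 0 ≤ s := by
    intro v s h
    by_contra hs
    push Not at hs
    have h1 := h (fun _ => true)
    have h2 := h (fun i => !(true))
    have e := sv_not (n := n) (fun _ => true)
    rw [e, inner_neg_right] at h2
    have := hb1 (fun _ => true)
    have := hb1 (fun _ => !true)
    nlinarith
  have main : ∀ v : VV n, P v ∈ F → ‖P v‖ = 1 → ∀ s : ℝ, (∀ ε, (inner ℝ v (sv ε) : ℝ) ≤ s * b ε) →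
        θ * √n ≤ s := by
    intro v hv hv1 s hs
    by_contra hlt
    push Not at hlt
    have hn : 0 < n := by
      rcases Nat.eq_zero_or_pos n with rfl | h
      · rw [Subsingleton.elim (P v) 0] at hv1
        norm_num at hv1
      · exact h
    have hnR : (0:ℝ) < n := by exact_mod_cast hn
    have hsn : 0 < √(n:ℝ) := Real.sqrt_pos.2 hnR
    have hsq : √(n:ℝ) * √n = n := Real.mul_self_sqrt hnR.le
    have hδ0 : 0 < δ := by positivity
    obtain ⟨z, hz1, hz2⟩ := rounding_aux (Finset.univ : Finset (Fin n))
      (fun i => (WithLp.toLp 2 (fun j => (P (r j)) i) : VV k)) (fun i => v i / δ)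
    set zz : VV n := WithLp.toLp 2 (fun i => (z i : ℝ)) with hzz
    set e : VV n := zz - (1/δ) • v with he
    have hei : ∀ i, e i = z i - v i / δ := by
      intro i; simp [he, hzz]; ring
    have hf0 : δ • zz = v + δ • e := by
      rw [he, smul_sub, smul_smul, mul_one_div_cancel hδ0.ne', one_smul]; abel
    have heb : ∀ i, |e i| ≤ 1 := fun i => by rw [hei]; exact hz1 i
    have hen : ‖e‖ ≤ √n := by
      rw [EuclideanSpace.norm_eq]
      apply Real.sqrt_le_sqrt
      calc ∑ i, ‖e i‖^2 ≤ ∑ i : Fin n, (1:ℝ) := by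
            apply Finset.sum_le_sum
            intro i _
            rw [Real.norm_eq_abs]
            have := heb i
            have := abs_nonneg (e i)
            nlinarith
        _ = n := by simp
    have hzG : z ∈ G := by
      rw [hG]
      constructor
      · intro ε
        have h1 : (inner ℝ (δ • zz) (sv ε) : ℝ) ≤ s * b ε + δ * n := by
          rw [hf0, inner_add_left, inner_smul_left]
          have h2 : (inner ℝ e (sv ε) : ℝ) ≤ n := by
            rw [inner_sv]
            calc ∑ i, e i * sg (ε i) ≤ ∑ i : Fin n, (1:ℝ) := by
                  apply Finset.sum_le_sum
                  intro i _
                  refine (le_abs_self _).trans ?_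
                  rw [abs_mul, sg_abs, mul_one]
                  exact heb i
              _ = n := by simp
          have := hs ε
          have : δ * (inner ℝ e (sv ε) : ℝ) ≤ δ * n := by gcongr
          simp only [conj_trivial]
          linarith
        rw [inner_smul_left, inner_sv] at h1
        have h3 : δ * n = θ * √n := by
          rw [hδ]; field_simp; rw [sq, hsq]
        have hb' := hb1 ε
        have h4 : s * b ε + δ * n ≤ δ * (2 * n * b ε) := by
          have : δ * (2 * n * b ε) = 2 * (θ * √n) * b ε := by rw [← h3]; ring
          rw [this, h3]
          have : 0 < θ * √n := by positivity
          nlinarith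
        exact le_of_mul_le_mul_left (h1.trans h4) hδ0
      · change 1/2 ≤ ‖P (δ • zz)‖
        rw [hf0, map_add, map_smul]
        have h1 : ‖δ • P e‖ ≤ 1/2 := by
          rw [norm_smul, Real.norm_eq_abs, abs_of_pos hδ0]
          have : ‖P e‖ ≤ ‖e‖ := E0.norm_starProjection_apply_le e
          calc δ * ‖P e‖ ≤ δ * √n := by gcongr; linarith
            _ = θ := by rw [hδ]; field_simp
            _ ≤ 1/2 := hθ2
        have := norm_sub_le (P v + δ • P e) (δ • P e)
        rw [add_sub_cancel_right, hv1] at this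
        linarith
    have hsym : ∀ x y : VV n, (inner ℝ x (P y) : ℝ) = inner ℝ (P x) y := fun x y =>
      (E0.inner_starProjection_left_eq_right x y).symm
    have hexp : Real.exp (-(k/2)) ≤ Real.exp (-∑ j, ((inner ℝ (r j) (P (δ • zz)) : ℝ)^2/θ^2)) := by
      apply Real.exp_le_exp.2
      have h1 : ∀ j, (inner ℝ (r j) (P (δ • zz)) : ℝ) = δ * inner ℝ (P (r j)) e := by
        intro j
        rw [hf0, map_add, inner_add_right, hFr _ hv j, zero_add, map_smul, inner_smul_right, hsym]
      have h2 : ∑ j, (inner ℝ (P (r j)) e : ℝ)^2 ≤ (1/4) * (k * (2 * n)) := by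
        have e1 : ‖∑ j, ((z j : ℝ) - v j / δ) • (WithLp.toLp 2 (fun j' => (P (r j')) j) : VV k)‖^2
            = ∑ j, (inner ℝ (P (r j)) e : ℝ)^2 := by
          rw [EuclideanSpace.norm_sq_eq]
          apply Finset.sum_congr rfl
          intro j _
          rw [Real.norm_eq_abs, sq_abs]
          congr 1
          simp [PiLp.inner_apply, hei]
        rw [← e1]
        refine hz2.trans ?_
        gcongr
        calc _ = ∑ j, ‖P (r j)‖^2 := by
              simp_rw [EuclideanSpace.norm_sq_eq]
              rw [Finset.sum_comm]
          _ ≤ ∑ j : Fin k, (2 * (n:ℝ)) := by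
              apply Finset.sum_le_sum
              intro j _
              refine le_trans ?_ (hr j)
              have := E0.norm_starProjection_apply_le (r j)
              gcongr
          _ = _ := by simp
      simp_rw [h1]
      rw [neg_le_neg_iff]
      calc ∑ j, (δ * (inner ℝ (P (r j)) e : ℝ))^2/θ^2 = δ^2/θ^2 * ∑ j, (inner ℝ (P (r j)) e : ℝ)^2 := by
            rw [Finset.mul_sum]; apply Finset.sum_congr rfl; intros; ring
        _ ≤ δ^2/θ^2 * ((1/4) * (k * (2 * n))) := by gcongr
        _ = k/2 := by
            rw [hδ, div_pow, Real.sq_sqrt hnR.le]; field_simp; norm_num; ring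
    have hsum := Finset.single_le_sum (f := fun z : Fin n → ℤ => Real.exp (-∑ j, ((inner ℝ (r j) (P (δ • (WithLp.toLp 2 (fun i => (z i : ℝ)) : VV n))) : ℝ)^2/θ^2)))
      (fun i _ => (Real.exp_pos _).le) hzG
    have : (G.card : ℝ) * (3 * θ)^k ≤ 768^n * (3*θ)^k := by gcongr
    have hfin := hexp.trans (hsum.trans (hrs.trans this))
    linarith
  intro v hv s hs
  rcases (norm_nonneg (P v)).eq_or_lt with h0 | h0
  · rw [← h0, mul_zero]; exact spos v s hs
  · have := main ((‖P v‖)⁻¹ • v) (by rw [map_smul]; exact F.smul_mem _ hv)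
      (by rw [map_smul, norm_smul, norm_inv, norm_norm, inv_mul_cancel₀ h0.ne']) ((‖P v‖)⁻¹ * s) (by
        intro ε
        rw [inner_smul_left, mul_assoc]
        simp only [conj_trivial]
        have := hs ε
        gcongr)
    rw [le_inv_mul_iff₀ h0] at this
    linarith

end PC

section PD

lemma semi_cont {n : ℕ} (N : Seminorm ℝ (VV n)) : Continuous N := by
  have h : ContinuousOn N Set.univ := ConvexOn.continuousOn isOpen_univ N.convexOn
  exact continuousOn_univ.1 h

lemma semi_sum {E : Type*} [AddCommGroup E] [Module ℝ E] (N : Seminorm ℝ E) {ι : Type*}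
    (s : Finset ι) (f : ι → E) : N (∑ i ∈ s, f i) ≤ ∑ i ∈ s, N (f i) := by
  classical
  induction s using Finset.induction_on with
  | empty => simp
  | insert i s hi ih =>
    rw [Finset.sum_insert hi, Finset.sum_insert hi]
    exact (map_add_le_add N _ _).trans (by linarith)

/-- vector valued average -/
def Exv {n : ℕ} {E : Type*} [AddCommGroup E] [Module ℝ E] (h : (Fin n → Bool) → E) : E :=
  ((1:ℝ) / 2 ^ n) • ∑ ε, h ε

lemma semi_Exv {n : ℕ} {E : Type*} [AddCommGroup E] [Module ℝ E] (N : Seminorm ℝ E)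
    (h : (Fin n → Bool) → E) : N (Exv h) ≤ Ex (fun ε => N (h ε)) := by
  unfold Exv Ex
  rw [map_smul_eq_mul, Real.norm_eq_abs, abs_of_pos (by positivity), one_div, inv_mul_eq_div]
  gcongr
  exact semi_sum N _ _

def ell {n : ℕ} (N : Seminorm ℝ (VV n)) (w : Fin n → VV n) : ℝ :=
  Ex (fun ε => N (∑ i, sg (ε i) • w i))

lemma ell_add {n : ℕ} (N : Seminorm ℝ (VV n)) (w w' : Fin n → VV n) :
    ell N (w + w') ≤ ell N w + ell N w' := by
  unfold ell
  rw [← Ex_add]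
  apply Ex_mono
  intro ε
  simp only [Pi.add_apply, smul_add, Finset.sum_add_distrib]
  exact map_add_le_add N _ _

lemma ell_smul {n : ℕ} (N : Seminorm ℝ (VV n)) (c : ℝ) (hc : 0 ≤ c) (w : Fin n → VV n) :
    ell N (c • w) = c * ell N w := by
  unfold ell
  rw [← Ex_mul]
  congr 1
  ext ε
  have : ∑ i, sg (ε i) • (c • w) i = c • ∑ i, sg (ε i) • w i := by
    rw [Finset.smul_sum]
    apply Finset.sum_congr rfl
    intro i _
    rw [Pi.smul_apply, smul_comm]
  rw [this, map_smul_eq_mul, Real.norm_eq_abs, abs_of_nonneg hc]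

lemma ell_nonneg {n : ℕ} (N : Seminorm ℝ (VV n)) (w : Fin n → VV n) : 0 ≤ ell N w :=
  Ex_nonneg fun _ => apply_nonneg _ _

lemma ell_cont {n : ℕ} (N : Seminorm ℝ (VV n)) : Continuous (ell N) := by
  unfold ell Ex
  have := semi_cont N
  fun_prop

/-- sflip coordinate i -/
def sflip {n : ℕ} (i : Fin n) (ε : Fin n → Bool) : Fin n → Bool := Function.update ε i (!(ε i))

lemma sflip_sflip {n : ℕ} (i : Fin n) (ε : Fin n → Bool) : sflip i (sflip i ε) = ε := by
  simp [sflip]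

def sflipE {n : ℕ} (i : Fin n) : (Fin n → Bool) ≃ (Fin n → Bool) :=
  ⟨sflip i, sflip i, sflip_sflip i, sflip_sflip i⟩

lemma Ex_sflip {n : ℕ} (i : Fin n) (h : (Fin n → Bool) → ℝ) : Ex (fun ε => h (sflip i ε)) = Ex h := by
  unfold Ex
  congr 1
  exact (sflipE i).sum_comp h

lemma col_le_ell {n : ℕ} (N : Seminorm ℝ (VV n)) (w : Fin n → VV n) (i : Fin n) :
    N (w i) ≤ ell N w := by
  have h0 : Ex (fun ε => N (∑ j, sg (sflip i ε j) • w j)) = ell N w :=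
    Ex_sflip i (fun ε => N (∑ j, sg (ε j) • w j))
  have h2 : ∀ ε : Fin n → Bool, 2 * N (w i) ≤
      N (∑ i_1, sg (sflip i ε i_1) • w i_1) + N (∑ i, sg (ε i) • w i) := by
    intro ε
    have h3 : (2 * sg (ε i)) • w i = ∑ i, sg (ε i) • w i - ∑ i_1, sg (sflip i ε i_1) • w i_1 := by
      rw [← Finset.sum_sub_distrib, Finset.sum_eq_single i]
      · simp [sflip, sg_not]; rw [← add_smul]; ring_nf
      · intro j _ hj
        simp [sflip, Function.update_of_ne hj]
      · simp
    have h4 : N ((2 * sg (ε i)) • w i) = 2 * N (w i) := by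
      rw [map_smul_eq_mul, Real.norm_eq_abs, abs_mul, sg_abs]; norm_num
    rw [← h4, h3]
    have := map_sub_le_add N (∑ i, sg (ε i) • w i) (∑ i_1, sg (sflip i ε i_1) • w i_1)
    linarith
  have := Ex_mono h2
  rw [Ex_const, Ex_add, h0] at this
  change _ ≤ ell N w + ell N w at this
  linarith

def cmat {n : ℕ} (w : Fin n → VV n) : Matrix (Fin n) (Fin n) ℝ := Matrix.of fun i j => w j i

lemma first_order {n : ℕ} (M : Matrix (Fin n) (Fin n) ℝ) (l : ℝ)
    (h : ∀ r : ℝ, 0 < r → Matrix.det (1 + r • M) ≤ (1 + r * l) ^ n) : M.trace ≤ n * l := by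
  set q := (Matrix.det (1 + (Polynomial.X : Polynomial ℝ) • M.map Polynomial.C)).divX.divX
  have hd : HasDerivAt (fun r : ℝ => (1 + r * l)^n - (1 + M.trace * r + q.eval r * r^2))
      (n * l - M.trace) 0 := by
    have h1 : HasDerivAt (fun r : ℝ => (1 + r * l)^n) (n * l) 0 := by
      have := (((hasDerivAt_id (0:ℝ)).mul_const l).const_add 1).pow n
      exact this.congr_deriv (by simp)
    have h2 : HasDerivAt (fun r : ℝ => (1 + M.trace * r + q.eval r * r^2)) M.trace 0 := by
      have := (((hasDerivAt_id (0:ℝ)).const_mul M.trace).const_add 1).add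
        ((q.hasDerivAt 0).mul ((hasDerivAt_id (0:ℝ)).pow 2))
      exact this.congr_deriv (by simp)
    exact h1.sub h2
  have ht := hd.tendsto_slope_zero_right
  have : 0 ≤ n * l - M.trace := by
    refine ge_of_tendsto ht ?_
    filter_upwards [self_mem_nhdsWithin] with r hr
    have hr' : 0 < r := hr
    have h1 := h r hr'
    rw [Matrix.det_one_add_smul] at h1
    simp only [zero_add, smul_eq_mul]
    apply mul_nonneg (by positivity)
    simp
    linarith
  linarith

lemma ell_pos {n : ℕ} (N : Seminorm ℝ (VV n)) (C : ℝ) (hC : ∀ u, ‖u‖ ≤ C * N u) :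
    ∃ T Ti : VV n →ₗ[ℝ] VV n, (∀ x, T (Ti x) = x) ∧ (∀ x, Ti (T x) = x) ∧
      Ex (fun ε => N (T (sv ε))) ≤ 1 ∧
      ∀ w : Fin n → VV n, ∑ i, (Ti (w i)) i ≤ n * Ex (fun ε => N (∑ i, sg (ε i) • w i)) := by
  classical
  set K : Set (Fin n → VV n) := {w | ell N w ≤ 1}
  have hKc : IsCompact K := by
    rw [Metric.isCompact_iff_isClosed_bounded]
    constructor
    · exact isClosed_le (ell_cont N) continuous_const
    · rw [isBounded_iff_forall_norm_le]
      refine ⟨|C|, fun w hw => ?_⟩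
      rw [pi_norm_le_iff_of_nonneg (abs_nonneg _)]
      intro i
      have h1 := col_le_ell N w i
      have h2 : ell N w ≤ 1 := hw
      have h3 := hC (w i)
      have h4 : 0 ≤ N (w i) := apply_nonneg _ _
      have h5 := le_abs_self C
      have h6 := abs_nonneg C
      nlinarith
  have hdc : Continuous (fun w : Fin n → VV n => |(cmat w).det|) := by
    apply Continuous.abs
    apply Continuous.matrix_det
    unfold cmat
    apply continuous_matrix
    intro i j
    simp only [Matrix.of_apply]
    fun_prop
  obtain ⟨t, htK, hmax⟩ := hKc.exists_isMaxOn ⟨0, by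
    change ell N 0 ≤ 1
    have := ell_smul N 0 le_rfl 0
    simp at this
    rw [this]; norm_num⟩ hdc.continuousOn
  have ht1 : ell N t ≤ 1 := htK
  have hmax' : ∀ w, ell N w ≤ 1 → |(cmat w).det| ≤ |(cmat t).det| := fun w hw => hmax hw
  have hcs : ∀ (c : ℝ) (w : Fin n → VV n), cmat (c • w) = c • cmat w := by
    intro c w; ext i j; simp [cmat]
  have hca : ∀ (w w' : Fin n → VV n), cmat (w + w') = cmat w + cmat w' := by
    intro c w; ext i j; simp [cmat]
  have hdet : 0 < |(cmat t).det| := by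
    set e : Fin n → VV n := fun i => EuclideanSpace.single i 1
    have he : cmat e = 1 := by
      ext i j
      simp [cmat, e, Matrix.one_apply, Pi.single_apply]
    set c := 1 / (1 + ell N e)
    have hl := ell_nonneg N e
    have hc : 0 < c := by positivity
    have := hmax' (c • e) (by
      rw [ell_smul N c hc.le, div_mul_eq_mul_div, one_mul, div_le_one (by positivity)]; linarith)
    refine lt_of_lt_of_le ?_ this
    rw [hcs, he, Matrix.det_smul, Matrix.det_one]
    simp
    positivity
  have hu : IsUnit (cmat t).det := by
    rw [isUnit_iff_ne_zero]; exact abs_pos.1 hdet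
  set A := cmat t
  refine ⟨Matrix.toEuclideanLin A, Matrix.toEuclideanLin A⁻¹, ?_, ?_, ?_, ?_⟩
  · intro x
    rw [Matrix.toLpLin_apply, Matrix.toLpLin_apply]
    simp [Matrix.mulVec_mulVec, Matrix.mul_nonsing_inv _ hu]
  · intro x
    rw [Matrix.toLpLin_apply, Matrix.toLpLin_apply]
    simp [Matrix.mulVec_mulVec, Matrix.nonsing_inv_mul _ hu]
  · refine le_trans (le_of_eq ?_) ht1
    unfold ell
    congr 1
    ext ε
    congr 1
    ext i
    simp [A, cmat, sv, Matrix.mulVec, dotProduct, mul_comm]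
  · intro w
    have htr : (A⁻¹ * cmat w).trace = ∑ i, (Matrix.toEuclideanLin A⁻¹ (w i)) i := by
      simp [Matrix.trace, Matrix.mul_apply, cmat, Matrix.mulVec, dotProduct]
    rw [← htr]
    change _ ≤ n * ell N w
    apply first_order
    intro r hr
    set l := ell N w
    have hl : 0 ≤ l := ell_nonneg N w
    have h1 : ell N (t + r • w) ≤ 1 + r * l := by
      refine (ell_add N _ _).trans ?_
      rw [ell_smul N r hr.le]; linarith
    have hp : 0 < 1 + r * l := by positivity
    have h2 := hmax' ((1 + r * l)⁻¹ • (t + r • w)) (by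
      rw [ell_smul N _ (by positivity), inv_mul_le_iff₀ hp]; linarith)
    have h3 : cmat (t + r • w) = A * (1 + r • (A⁻¹ * cmat w)) := by
      rw [hca, hcs, mul_add, mul_one, Matrix.mul_smul, ← mul_assoc, Matrix.mul_nonsing_inv _ hu, one_mul]
    rw [hcs, Matrix.det_smul, h3, Matrix.det_mul, abs_mul, abs_mul, Fintype.card_fin, abs_of_pos (by positivity),
      mul_left_comm, inv_pow] at h2
    have h4 := le_of_mul_le_mul_left (by linarith : |A.det| * (((1 + r*l)^n)⁻¹ * |Matrix.det (1 + r • (A⁻¹ * cmat w))|) ≤ |A.det| * 1) hdet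
    rw [inv_mul_le_iff₀ (by positivity), mul_one] at h4
    exact (le_abs_self _).trans h4

end PD

section PE

def chi {n : ℕ} (S : Finset (Fin n)) (ε : Fin n → Bool) : ℝ := ∏ i ∈ S, sg (ε i)

lemma chi_sq {n : ℕ} (S : Finset (Fin n)) (ε : Fin n → Bool) : chi S ε * chi S ε = 1 := by
  unfold chi
  rw [← Finset.prod_mul_distrib]
  exact Finset.prod_eq_one fun i _ => sg_sq _

lemma chi_sflip_mem {n : ℕ} (S : Finset (Fin n)) (i : Fin n) (hi : i ∈ S) (ε : Fin n → Bool) :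
    chi S (sflip i ε) = - chi S ε := by
  classical
  unfold chi
  rw [← Finset.mul_prod_erase S _ hi, ← Finset.mul_prod_erase S (fun i => sg (ε i)) hi]
  have : ∏ j ∈ S.erase i, sg (sflip i ε j) = ∏ j ∈ S.erase i, sg (ε j) := by
    apply Finset.prod_congr rfl
    intro j hj
    simp [sflip, Function.update_of_ne (Finset.ne_of_mem_erase hj)]
  rw [this]
  simp [sflip, sg_not]

lemma chi_sflip_notMem {n : ℕ} (S : Finset (Fin n)) (i : Fin n) (hi : i ∉ S) (ε : Fin n → Bool) :
    chi S (sflip i ε) = chi S ε := by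
  unfold chi
  apply Finset.prod_congr rfl
  intro j hj
  have : j ≠ i := by rintro rfl; exact hi hj
  simp [sflip, Function.update_of_ne this]

lemma Ex_neg_flip {n : ℕ} (i : Fin n) (h : (Fin n → Bool) → ℝ) (hh : ∀ ε, h (sflip i ε) = - h ε) :
    Ex h = 0 := by
  have h1 := Ex_sflip i h
  have h2 : Ex (fun ε => h (sflip i ε)) = - Ex h := by
    have := Ex_mul (-1) h
    rw [neg_one_mul] at this
    rw [← this]
    congr 1
    ext ε
    rw [hh]; ring
  linarith

lemma chi_orth {n : ℕ} (S T : Finset (Fin n)) :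
    Ex (fun ε => chi S ε * chi T ε) = if S = T then 1 else 0 := by
  classical
  split_ifs with h
  · subst h
    simp_rw [chi_sq]
    exact Ex_const 1
  · have : ∃ i, ¬ (i ∈ S ↔ i ∈ T) := by
      by_contra hc
      push Not at hc
      exact h (Finset.ext hc)
    obtain ⟨i, hi⟩ := this
    apply Ex_neg_flip i
    intro ε
    by_cases hS : i ∈ S
    · have hT : i ∉ T := fun hT => hi ⟨fun _ => hT, fun _ => hS⟩
      rw [chi_sflip_mem S i hS, chi_sflip_notMem T i hT]; ring
    · have hT : i ∈ T := by
        by_contra hT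
        exact hi ⟨fun h => absurd h hS, fun h => absurd h hT⟩
      rw [chi_sflip_notMem S i hS, chi_sflip_mem T i hT]; ring

lemma parseval {n : ℕ} {H : Type*} [NormedAddCommGroup H] [InnerProductSpace ℝ H]
    (c : Finset (Fin n) → H) : Ex (fun ε => ‖∑ S, chi S ε • c S‖^2) = ∑ S, ‖c S‖^2 := by
  classical
  have h1 : ∀ ε : Fin n → Bool, ‖∑ S, chi S ε • c S‖^2 =
      ∑ S, ∑ T, (inner ℝ (c S) (c T) : ℝ) * (chi S ε * chi T ε) := by
    intro ε
    rw [← real_inner_self_eq_norm_sq, sum_inner]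
    apply Finset.sum_congr rfl
    intro S _
    rw [inner_sum]
    apply Finset.sum_congr rfl
    intro T _
    rw [inner_smul_left, inner_smul_right]
    simp only [conj_trivial]
    ring
  simp_rw [h1, Ex_sum, Ex_mul, chi_orth]
  simp

lemma inner_Exv {n : ℕ} {H : Type*} [NormedAddCommGroup H] [InnerProductSpace ℝ H]
    (c : H) (φ : (Fin n → Bool) → H) : (inner ℝ c (Exv φ) : ℝ) = Ex (fun ε => inner ℝ c (φ ε)) := by
  unfold Exv Ex
  rw [inner_smul_right, inner_sum]
  ring

lemma bessel {n : ℕ} {H : Type*} [NormedAddCommGroup H] [InnerProductSpace ℝ H]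
    (φ : (Fin n → Bool) → H) :
    ∑ S, ‖Exv (fun ε => chi S ε • φ ε)‖^2 ≤ Ex (fun ε => ‖φ ε‖^2) := by
  classical
  set c : Finset (Fin n) → H := fun S => Exv (fun ε => chi S ε • φ ε) with hc
  have h0 : 0 ≤ Ex (fun ε => ‖φ ε - ∑ S, chi S ε • c S‖^2) := Ex_nonneg fun _ => by positivity
  have h1 : ∀ ε, ‖φ ε - ∑ S, chi S ε • c S‖^2 =
      ‖φ ε‖^2 - 2 * (∑ S, inner ℝ (c S) (chi S ε • φ ε)) + ‖∑ S, chi S ε • c S‖^2 := by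
    intro ε
    rw [norm_sub_sq_real, inner_sum]
    congr 3
    apply Finset.sum_congr rfl
    intro S _
    rw [inner_smul_right, inner_smul_right, real_inner_comm]
  simp_rw [h1] at h0
  rw [Ex_add, Ex_sub, Ex_mul, Ex_sum, parseval] at h0
  simp_rw [← inner_Exv] at h0
  have h2 : ∀ S, (inner ℝ (c S) (Exv fun ε => chi S ε • φ ε) : ℝ) = ‖c S‖^2 := fun S =>
    real_inner_self_eq_norm_sq (c S)
  simp_rw [h2] at h0
  linarith

lemma Exv_sum {n : ℕ} {E : Type*} [AddCommGroup E] [Module ℝ E] {ι : Type*} (s : Finset ι)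
    (h : ι → (Fin n → Bool) → E) :
    Exv (fun ε => ∑ i ∈ s, h i ε) = ∑ i ∈ s, Exv (h i) := by
  unfold Exv
  rw [Finset.sum_comm, Finset.smul_sum]

lemma Exv_smul {n : ℕ} {E : Type*} [AddCommGroup E] [Module ℝ E] (c : ℝ)
    (h : (Fin n → Bool) → E) :
    Exv (fun ε => c • h ε) = c • Exv h := by
  unfold Exv
  rw [← Finset.smul_sum, smul_comm]

lemma Exv_add {n : ℕ} {E : Type*} [AddCommGroup E] [Module ℝ E]
    (h g : (Fin n → Bool) → E) :
    Exv (fun ε => h ε + g ε) = Exv h + Exv g := by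
  unfold Exv
  rw [Finset.sum_add_distrib, smul_add]

lemma prod_walsh {n : ℕ} (ρ : ℝ) (x y : Fin n → Bool) :
    ∏ i, (1 + ρ * (sg (x i) * sg (y i))) = ∑ S, ρ ^ S.card * (chi S x * chi S y) := by
  classical
  rw [Finset.prod_one_add]
  simp only [Finset.powerset_univ]
  apply Finset.sum_congr rfl
  intro S _
  rw [Finset.prod_mul_distrib, Finset.prod_mul_distrib, Finset.prod_const]
  rfl

lemma Ex_prod {n : ℕ} (ρ : ℝ) (x : Fin n → Bool) :
    Ex (fun y => ∏ i, (1 + ρ * (sg (x i) * sg (y i)))) = 1 := by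
  classical
  simp_rw [prod_walsh, Ex_sum]
  have : ∀ S : Finset (Fin n), Ex (fun y => ρ ^ S.card * (chi S x * chi S y)) = if S = ∅ then 1 else 0 := by
    intro S
    have h1 : Ex (fun y => ρ ^ S.card * (chi S x * chi S y)) =
        (ρ ^ S.card * chi S x) * Ex (fun y => chi S y * chi ∅ y) := by
      rw [← Ex_mul]
      congr 1; ext y; simp [chi]; ring
    rw [h1, chi_orth]
    split_ifs with h
    · subst h; simp [chi]
    · simp
  simp_rw [this]
  simp

lemma sum_card_one {n : ℕ} (x y : Fin n → Bool) :
    ∑ i, sg (x i) * sg (y i) = ∑ S : Finset (Fin n), (if S.card = 1 then 1 else 0) * (chi S x * chi S y) := by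
  classical
  simp only [ite_mul, one_mul, zero_mul]
  rw [← Finset.sum_filter]
  have : (Finset.univ.filter (fun S : Finset (Fin n) => S.card = 1)) =
      Finset.univ.image (fun i : Fin n => ({i} : Finset (Fin n))) := by
    ext S
    simp [Finset.card_eq_one, eq_comm]
  rw [this, Finset.sum_image (by intro a _ b _ h; simpa using h)]
  simp [chi]

lemma mult_bound (ρ : ℝ) (h0 : 0 < ρ) (h1 : ρ ≤ 1) (k : ℕ) :
    |(if k = 1 then 1 else 0) - (ρ^k - (-ρ)^k)/(2*ρ)| ≤ ρ^2 := by
  rcases Nat.even_or_odd k with he | ho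
  · rw [he.neg_pow]
    have : k ≠ 1 := by rintro rfl; simp at he
    simp [this]; positivity
  · rw [ho.neg_pow]
    obtain ⟨m, rfl⟩ := ho
    have e : (ρ^(2*m+1) - -ρ^(2*m+1))/(2*ρ) = (ρ^2)^m := by
      rw [← pow_mul]
      field_simp
      ring
    rw [e]
    rcases m with _ | m
    · simp; positivity
    · simp
      have : (ρ^2)^m ≤ 1 := pow_le_one₀ (by positivity) (by nlinarith)
      rw [pow_succ]
      nlinarith [sq_nonneg ρ]

lemma kconv {n : ℕ} (N : Seminorm ℝ (VV n)) (d : ℝ) (hd : 0 < d) (hN : ∀ u, N u ≤ ‖u‖)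
    (hN2 : ∀ u, ‖u‖ ≤ d * N u) (φ : (Fin n → Bool) → VV n) (hφ : ∀ ε, N (φ ε) ≤ 1)
    (ρ : ℝ) (h0 : 0 < ρ) (h1 : ρ ≤ 1) :
    Ex (fun x => N (∑ i, sg (x i) • Exv (fun ε => sg (ε i) • φ ε))) ≤ 1/ρ + ρ^2 * d := by
  classical
  set q : (Fin n → Bool) → (Fin n → Bool) → ℝ := fun x y => ∑ i, sg (x i) * sg (y i) with hq
  set r : (Fin n → Bool) → (Fin n → Bool) → ℝ := fun x y =>
    ((∏ i, (1 + ρ * (sg (x i) * sg (y i)))) - ∏ i, (1 + (-ρ) * (sg (x i) * sg (y i)))) / (2*ρ) with hr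
  set m : Finset (Fin n) → ℝ := fun S => (if S.card = 1 then 1 else 0) - (ρ^S.card - (-ρ)^S.card)/(2*ρ) with hm
  set c : Finset (Fin n) → VV n := fun S => Exv (fun ε => chi S ε • φ ε) with hc
  have hqr : ∀ x y, q x y = r x y + ∑ S, m S * (chi S x * chi S y) := by
    intro x y
    simp only [hq, hr, hm]
    rw [sum_card_one, prod_walsh, prod_walsh, ← Finset.sum_sub_distrib, Finset.sum_div, ← Finset.sum_add_distrib]
    apply Finset.sum_congr rfl
    intro S _
    ring
  have hQ : ∀ x, ∑ i, sg (x i) • Exv (fun ε => sg (ε i) • φ ε) =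
      Exv (fun y => r x y • φ y) + ∑ S, chi S x • (m S • c S) := by
    intro x
    have e1 : ∑ i, sg (x i) • Exv (fun ε => sg (ε i) • φ ε) = Exv (fun y => q x y • φ y) := by
      simp_rw [← Exv_smul]
      rw [← Exv_sum]
      congr 1
      ext1 y
      simp only [hq]
      rw [Finset.sum_smul]
      simp_rw [smul_smul]
    have e2 : ∑ S, chi S x • (m S • c S) = Exv (fun y => (∑ S, m S * (chi S x * chi S y)) • φ y) := by
      simp_rw [hc, ← Exv_smul]
      rw [← Exv_sum]
      congr 1
      ext1 y
      rw [Finset.sum_smul]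
      apply Finset.sum_congr rfl
      intro S _
      rw [smul_smul, smul_smul]
      congr 1
      ring
    rw [e1, e2, ← Exv_add]
    congr 1
    ext1 y
    rw [hqr, add_smul]
  have hsgb : ∀ a b : Bool, |sg a * sg b| = 1 := by intro a b; rw [abs_mul, sg_abs, sg_abs, one_mul]
  have hRb : ∀ x, N (Exv (fun y => r x y • φ y)) ≤ 1/ρ := by
    intro x
    refine (semi_Exv N _).trans ?_
    have hb : ∀ y, N (r x y • φ y) ≤ (1/(2*ρ)) * ((∏ i, (1 + ρ * (sg (x i) * sg (y i)))) +
        ∏ i, (1 + (-ρ) * (sg (x i) * sg (y i)))) := by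
      intro y
      have p1 : 0 ≤ ∏ i, (1 + ρ * (sg (x i) * sg (y i))) := by
        apply Finset.prod_nonneg
        intro i _
        have := abs_le.1 (hsgb (x i) (y i)).le
        nlinarith
      have p2 : 0 ≤ ∏ i, (1 + (-ρ) * (sg (x i) * sg (y i))) := by
        apply Finset.prod_nonneg
        intro i _
        have := abs_le.1 (hsgb (x i) (y i)).le
        nlinarith
      rw [map_smul_eq_mul, Real.norm_eq_abs]
      have : |r x y| ≤ (1/(2*ρ)) * ((∏ i, (1 + ρ * (sg (x i) * sg (y i)))) +
        ∏ i, (1 + (-ρ) * (sg (x i) * sg (y i)))) := by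
        simp only [hr]
        rw [abs_div, abs_of_pos (by positivity : 0 < 2*ρ), one_div, inv_mul_eq_div]
        gcongr
        rw [abs_le]; constructor <;> linarith
      have h3 := hφ y
      have h4 := abs_nonneg (r x y)
      have h5 : 0 ≤ N (φ y) := apply_nonneg _ _
      nlinarith
    refine (Ex_mono hb).trans ?_
    rw [Ex_mul, Ex_add, Ex_prod, Ex_prod]
    apply le_of_eq
    field_simp
    norm_num
  have hdiff : Ex (fun x => N (∑ S, chi S x • (m S • c S))) ≤ ρ^2 * d := by
    set B := ρ^2 * d with hB
    have hBp : 0 < B := by positivity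
    have e1 : Ex (fun x => ‖∑ S, chi S x • (m S • c S)‖^2) ≤ B^2 := by
      rw [parseval]
      calc _ ≤ ∑ S, (ρ^2)^2 * ‖c S‖^2 := by
            apply Finset.sum_le_sum
            intro S _
            rw [norm_smul, mul_pow, Real.norm_eq_abs]
            have := mult_bound ρ h0 h1 S.card
            gcongr
        _ = (ρ^2)^2 * ∑ S, ‖c S‖^2 := by rw [Finset.mul_sum]
        _ ≤ (ρ^2)^2 * d^2 := by
            gcongr
            refine (bessel φ).trans ?_
            rw [← Ex_const (n := n) (d^2)]
            apply Ex_mono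
            intro ε
            have := hN2 (φ ε)
            have h3 := hφ ε
            have : ‖φ ε‖ ≤ d := by nlinarith
            gcongr
        _ = B^2 := by rw [hB]; ring
    have e2 : ∀ x, N (∑ S, chi S x • (m S • c S)) ≤ (1/(2*B)) * ‖∑ S, chi S x • (m S • c S)‖^2 + B/2 := by
      intro x
      refine (hN _).trans ?_
      set g := ‖∑ S, chi S x • (m S • c S)‖
      have : (1/(2*B)) * g^2 + B/2 - g = (g - B)^2/(2*B) := by field_simp; ring
      have h3 : 0 ≤ (g-B)^2/(2*B) := by positivity
      linarith
    refine (Ex_mono e2).trans ?_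
    rw [Ex_add, Ex_mul, Ex_const]
    calc _ ≤ (1/(2*B)) * B^2 + B/2 := by gcongr
      _ = B := by field_simp; ring
  calc _ ≤ Ex (fun x => 1/ρ + N (∑ S, chi S x • (m S • c S))) := by
        apply Ex_mono
        intro x
        rw [hQ]
        exact (map_add_le_add N _ _).trans (by linarith [hRb x])
    _ ≤ _ := by
        rw [Ex_add, Ex_const]; linarith

lemma norming {n : ℕ} (N : Seminorm ℝ (VV n)) (C : ℝ) (hC : ∀ u, ‖u‖ ≤ C * N u)
    (L : VV n →ₗ[ℝ] ℝ) : ∃ z, N z ≤ 1 ∧ 0 ≤ L z ∧ ∀ u, L u ≤ N u * L z := by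
  have hKc : IsCompact {u : VV n | N u ≤ 1} := by
    rw [Metric.isCompact_iff_isClosed_bounded]
    constructor
    · exact isClosed_le (semi_cont N) continuous_const
    · rw [isBounded_iff_forall_norm_le]
      refine ⟨|C|, fun u hu => ?_⟩
      have h2 : N u ≤ 1 := hu
      have h3 := hC u
      have h4 : 0 ≤ N u := apply_nonneg _ _
      have h5 := le_abs_self C
      have h6 := abs_nonneg C
      nlinarith
  obtain ⟨z, hz, hmax⟩ := hKc.exists_isMaxOn ⟨0, by simp⟩ (L.continuous_of_finiteDimensional).continuousOn
  have hmax' : ∀ u, N u ≤ 1 → L u ≤ L z := fun u hu => hmax hu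
  refine ⟨z, hz, by simpa using hmax' 0 (by simp), fun u => ?_⟩
  rcases (apply_nonneg N u).eq_or_lt with h | h
  · have := hC u
    rw [← h, mul_zero, norm_le_zero_iff] at this
    rw [this]; simp
  · have := hmax' ((N u)⁻¹ • u) (by
      rw [map_smul_eq_mul, norm_inv, Real.norm_eq_abs, abs_of_pos h, inv_mul_cancel₀ h.ne'])
    rw [map_smul, smul_eq_mul, inv_mul_le_iff₀ h] at this
    exact this

lemma lstar {n : ℕ} (N : Seminorm ℝ (VV n)) (δ : ℝ) (hδ : 1 ≤ δ) (hN : ∀ u, N u ≤ ‖u‖)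
    (hN2 : ∀ u, ‖u‖ ≤ δ^3 * N u) :
    ∃ T Ti : VV n →ₗ[ℝ] VV n, (∀ x, T (Ti x) = x) ∧ (∀ x, Ti (T x) = x) ∧
      Ex (fun ε => N (T (sv ε))) ≤ 1 ∧
      ∃ Nst : (Fin n → Bool) → ℝ, (∀ ε, 0 ≤ Nst ε) ∧ Ex Nst ≤ n * (2 * δ) ∧
        ∀ u ε, (inner ℝ u (sv ε) : ℝ) ≤ N (T u) * Nst ε := by
  obtain ⟨T, Ti, h1, h2, h3, h4⟩ := ell_pos N _ hN2
  refine ⟨T, Ti, h1, h2, h3, ?_⟩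
  choose φ hφ1 hφ2 hφ3 using fun ε : Fin n → Bool =>
    norming N _ hN2 ((innerSL ℝ (sv ε)).toLinearMap ∘ₗ Ti)
  refine ⟨fun ε => ((innerSL ℝ (sv ε)).toLinearMap ∘ₗ Ti) (φ ε), hφ2, ?_, ?_⟩
  · have hδ0 : 0 < δ := by linarith
    have hk := kconv N (δ^3) (by positivity) hN hN2 φ hφ1 (1/δ) (by positivity)
      (by rw [div_le_one hδ0]; exact hδ)
    have hw := h4 (fun i => Exv (fun ε => sg (ε i) • φ ε))
    calc _ = ∑ i, (Ti (Exv (fun ε => sg (ε i) • φ ε))) i := by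
          have : ∀ i, (Ti (Exv (fun ε => sg (ε i) • φ ε))) i = Ex (fun ε => sg (ε i) * (Ti (φ ε)) i) := by
            intro i
            unfold Exv Ex
            simp [map_sum]
            ring
          simp_rw [this]
          rw [← Ex_sum]
          congr 1
          ext ε
          simp only [LinearMap.comp_apply, ContinuousLinearMap.coe_coe, innerSL_apply_apply]
          rw [real_inner_comm, inner_sv]
          apply Finset.sum_congr rfl
          intros; ring
      _ ≤ _ := hw
      _ ≤ n * (1/(1/δ) + (1/δ)^2 * δ^3) := by gcongr
      _ = n * (2*δ) := by field_simp; ring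
  · intro u ε
    have := hφ3 ε (T u)
    simp only [LinearMap.comp_apply, ContinuousLinearMap.coe_coe, innerSL_apply_apply, h2] at this
    rw [real_inner_comm]
    exact this

end PE

section PF

def HasAnt {E : Type*} [AddCommGroup E] [Module ℝ E] (N : Seminorm ℝ E) (M : ℕ) : Prop :=
  ∃ x : Fin M → E, (∀ i, N (x i) < 1) ∧ ∀ i j, i ≠ j → ∃ f : E →ₗ[ℝ] ℝ, (∀ v, f v ≤ N v) ∧
    1 < f (x i) - f (x j) ∧ ∀ l, f (x j) ≤ f (x l) ∧ f (x l) ≤ f (x i)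

lemma HasAnt.transfer {E E' : Type*} [AddCommGroup E] [Module ℝ E] [AddCommGroup E'] [Module ℝ E']
    (N : Seminorm ℝ E) (N' : Seminorm ℝ E') (Z : Submodule ℝ E) (q : Z →ₗ[ℝ] E')
    (h1 : ∀ z : Z, N' (q z) ≤ N z) (h2 : ∀ y, N' y < 1 → ∃ z : Z, q z = y ∧ N z < 1)
    {M : ℕ} (h : HasAnt N' M) : HasAnt N M := by
  obtain ⟨x', hx', hf'⟩ := h
  choose z hz hzN using fun i => h2 (x' i) (hx' i)
  refine ⟨fun i => z i, hzN, fun i j hij => ?_⟩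
  obtain ⟨f', hf1, hf2, hf3⟩ := hf' i j hij
  obtain ⟨g, hg1, hg2⟩ := exists_extension_of_le_sublinear (⟨Z, f' ∘ₗ q⟩ : E →ₗ.[ℝ] ℝ) N
    (fun c hc x => by rw [map_smul_eq_mul, Real.norm_eq_abs, abs_of_pos hc])
    (fun x y => map_add_le_add N x y) (fun x => (hf1 (q x)).trans (h1 x))
  have hg : ∀ l, g (z l) = f' (x' l) := fun l => by
    have : g (z l) = f' (q (z l)) := hg1 (z l)
    rw [this, hz]
  refine ⟨g, hg2, ?_, fun l => ?_⟩
  · rw [hg, hg]; exact hf2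
  · rw [hg, hg, hg]; exact hf3 l

lemma HasAnt.of_equiv {E E' : Type*} [AddCommGroup E] [Module ℝ E] [AddCommGroup E'] [Module ℝ E']
    (N : Seminorm ℝ E') (T : E →ₗ[ℝ] E') (Ti : E' →ₗ[ℝ] E) (h1 : ∀ x, T (Ti x) = x)
    (h2 : ∀ x, Ti (T x) = x) {M : ℕ} (h : HasAnt (N.comp T) M) : HasAnt N M := by
  obtain ⟨x, hx, hf⟩ := h
  refine ⟨fun i => T (x i), hx, fun i j hij => ?_⟩
  obtain ⟨f, hf1, hf2, hf3⟩ := hf i j hij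
  refine ⟨f ∘ₗ Ti, fun v => ?_, ?_, fun l => ?_⟩
  · have := hf1 (Ti v)
    simpa [h1] using this
  · simpa [h2] using hf2
  · simpa [h2] using hf3 l

lemma stage1 {n : ℕ} (NT : Seminorm ℝ (VV n)) (F : Submodule ℝ (VV n)) (β : ℝ)
    (h : ∀ v ∈ F, ∀ s : ℝ, (∀ ε, (inner ℝ v (sv ε) : ℝ) ≤ s * (1 + NT (sv ε))) → β * ‖v‖ ≤ s)
    (u : VV n) (hu : u ∈ F) (hun : ‖u‖ < β) : ∃ x, F.starProjection x = u ∧ NT x < 1 := by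
  by_contra hcon
  push Not at hcon
  set s : Set (VV n) := {x | ∃ w ∈ Fᗮ, NT (x + w) < 1} with hs
  have hconv : Convex ℝ s := by
    rintro x ⟨w, hw, hx⟩ y ⟨w', hw', hy⟩ a b ha hb hab
    refine ⟨a • w + b • w', add_mem (Submodule.smul_mem _ _ hw) (Submodule.smul_mem _ _ hw'), ?_⟩
    have e : a • x + b • y + (a • w + b • w') = a • (x + w) + b • (y + w') := by
      simp only [smul_add]; abel
    rw [e]
    have h1 := map_add_le_add NT (a • (x+w)) (b • (y + w'))
    rw [map_smul_eq_mul, map_smul_eq_mul, Real.norm_eq_abs, Real.norm_eq_abs, abs_of_nonneg ha, abs_of_nonneg hb] at h1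
    rcases ha.eq_or_lt with h0 | h0
    · subst h0
      have : b = 1 := by linarith
      subst this
      linarith
    · nlinarith
  have hopen : IsOpen s := by
    have : s = ⋃ w : Fᗮ, {x | NT (x + w) < 1} := by
      ext x; simp [hs]
    rw [this]
    apply isOpen_iUnion
    intro w
    have := semi_cont NT
    exact isOpen_lt (by fun_prop) continuous_const
  have hus : u ∉ s := by
    rintro ⟨w, hw, hx⟩
    have h1 := hcon (u + w) (by
      rw [map_add, Submodule.starProjection_eq_self_iff.2 hu,
        (Submodule.starProjection_apply_eq_zero_iff (K := F)).2 hw, add_zero])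
    linarith
  obtain ⟨f, hf⟩ := geometric_hahn_banach_open_point hconv hopen hus
  obtain ⟨v, hv⟩ : ∃ v : VV n, ∀ x, f x = inner ℝ v x :=
    ⟨(InnerProductSpace.toDual ℝ (VV n)).symm f, fun x => by simp⟩
  have hball : ∀ x, NT x < 1 → f x < f u := fun x hx => hf x ⟨0, zero_mem _, by simpa using hx⟩
  have hperp : ∀ w ∈ Fᗮ, ∀ t : ℝ, t * f w < f u := by
    intro w hw t
    have := hf (t • w) ⟨-(t • w), neg_mem (Submodule.smul_mem _ _ hw), by simp⟩
    simpa using this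
  have hfu : 0 < f u := by simpa using hball 0 (by simp)
  have hz : ∀ w ∈ Fᗮ, f w = 0 := by
    intro w hw
    by_contra hne
    have := hperp w hw (f u / f w)
    rw [div_mul_cancel₀ _ hne] at this
    exact lt_irrefl _ this
  have hvF : v ∈ F := by
    rw [← Submodule.orthogonal_orthogonal F, Submodule.mem_orthogonal']
    intro w hw
    rw [← hv, hz w hw]
  have h1 := h v hvF (f u) (by
    intro ε
    have hp : 0 ≤ NT (sv ε) := apply_nonneg _ _
    have hp1 : 0 < 1 + NT (sv ε) := by linarith
    have := hball ((1 + NT (sv ε))⁻¹ • sv ε) (by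
      rw [map_smul_eq_mul, norm_inv, Real.norm_eq_abs, abs_of_pos hp1, inv_mul_lt_iff₀ hp1]; linarith)
    rw [map_smul, smul_eq_mul, inv_mul_lt_iff₀ hp1, hv] at this
    linarith)
  have h2 : f u ≤ ‖v‖ * ‖u‖ := by rw [hv]; exact real_inner_le_norm v u
  have hv0 : 0 < ‖v‖ := by
    rcases (norm_nonneg v).eq_or_lt with h0 | h0
    · rw [← h0] at h2; linarith
    · exact h0
  nlinarith

lemma step {n : ℕ} (hn : 0 < n) (N : Seminorm ℝ (VV n)) (δ : ℝ) (hδ : 1 ≤ δ) (hN : ∀ u, N u ≤ ‖u‖)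
    (hN2 : ∀ u, ‖u‖ ≤ δ^3 * N u) (k : ℕ) (θ : ℝ) (hθ : 0 < θ) (hθ2 : θ ≤ 1/2)
    (hsmall : 768 ^ n * (3 * θ) ^ k < Real.exp (-(k/2))) :
    ∃ m, m ≤ n ∧ n ≤ m + 2 * k ∧ ∃ N' : Seminorm ℝ (VV m), (∀ u, N' u ≤ ‖u‖) ∧
      (∀ u, ‖u‖ ≤ (2 * δ / θ^2) * N' u) ∧ ∀ M, HasAnt N' M → HasAnt N M := by
  obtain ⟨T, Ti, hT1, hT2, hT3, Nst, hst0, hst1, hst2⟩ := lstar N δ hδ hN hN2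
  set NT := N.comp T with hNT
  have hnR : (0:ℝ) < n := by exact_mod_cast hn
  have hsn : 0 < √(n:ℝ) := Real.sqrt_pos.2 hnR
  have hsq : √(n:ℝ) * √n = n := Real.mul_self_sqrt hnR.le
  obtain ⟨F1, -, hF1d, hF1⟩ := lemP (k := k) (fun ε => 1 + NT (sv ε))
    (fun ε => by have : 0 ≤ NT (sv ε) := apply_nonneg _ _; linarith)
    (by rw [Ex_add, Ex_const]; have : Ex (fun ε => NT (sv ε)) ≤ 1 := hT3; linarith) ⊤ θ hθ hθ2 hsmall
  have hA : ∀ u ∈ F1, ∀ t : ℝ, ‖u‖ < θ * √n * t → ∃ x, F1.starProjection x = u ∧ NT x < t := by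
    intro u hu t ht
    have ht0 : 0 < t := by
      by_contra hc
      push Not at hc
      have := norm_nonneg u
      have : 0 < θ * √n := by positivity
      nlinarith
    obtain ⟨x, hx1, hx2⟩ := stage1 NT F1 (θ * √n) (by
      intro v hv s hs
      have htop : (⊤ : Submodule ℝ (VV n)).starProjection v = v :=
        Submodule.starProjection_eq_self_iff.2 Submodule.mem_top
      have := hF1 v (by rw [htop]; exact hv) s hs
      rw [htop] at this
      exact this) (t⁻¹ • u) (F1.smul_mem _ hu) (by
        rw [norm_smul, norm_inv, Real.norm_eq_abs, abs_of_pos ht0, inv_mul_lt_iff₀ ht0]; linarith)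
    refine ⟨t • x, ?_, ?_⟩
    · rw [map_smul, hx1, smul_smul, mul_inv_cancel₀ ht0.ne', one_smul]
    · rw [map_smul_eq_mul, Real.norm_eq_abs, abs_of_pos ht0]
      nlinarith
  have hδ0 : 0 < δ := by linarith
  have hc0 : 0 < n * (2 * δ) := by positivity
  obtain ⟨F2, hF21, hF2d, hF2⟩ := lemP (k := k) (fun ε => 1 + (1/(n * (2*δ))) * Nst ε)
    (fun ε => by
      have : 0 ≤ (1/(n * (2*δ))) * Nst ε := mul_nonneg (by positivity) (hst0 ε)
      linarith)
    (by
      rw [Ex_add, Ex_const, Ex_mul, one_div, inv_mul_eq_div]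
      have := (div_le_one hc0).2 hst1
      linarith) F1 θ hθ hθ2 hsmall
  set P := F1.starProjection with hP
  have hB : ∀ v, P v ∈ F2 → θ * √n * ‖P v‖ ≤ n * (2*δ) * NT v := by
    intro v hv
    apply hF2 v hv
    intro ε
    have h1 : inner ℝ v (sv ε) ≤ NT v * Nst ε := hst2 v ε
    have h2 : 0 ≤ n * (2*δ) * NT v := mul_nonneg hc0.le (apply_nonneg _ _)
    have h3 : n * (2*δ) * NT v * (1 + (1/(n * (2*δ))) * Nst ε) = n * (2*δ) * NT v + NT v * Nst ε := by
      field_simp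
    rw [h3]
    linarith
  set B := 1 / (θ * √n) with hBdef
  have hB0 : 0 < B := by positivity
  set m := Module.finrank ℝ F2 with hm
  set e := (stdOrthonormalBasis ℝ F2).repr with he
  set Nq : Seminorm ℝ (VV n) := NT ⊓ (normSeminorm ℝ (VV n)).comp (B • P.toLinearMap) with hNq
  have hbdd : ∀ y, BddBelow (Set.range fun w => NT w + ((normSeminorm ℝ (VV n)).comp (B • P.toLinearMap)) (y - w)) :=
    fun y => ⟨0, by rintro _ ⟨w, rfl⟩; exact add_nonneg (apply_nonneg _ _) (apply_nonneg _ _)⟩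
  have hcomp : ∀ y, ((normSeminorm ℝ (VV n)).comp (B • P.toLinearMap)) y = B * ‖P y‖ := by
    intro y
    simp [Seminorm.comp_apply, norm_smul, abs_of_pos hB0]
  have hle : ∀ y w, Nq y ≤ NT w + B * ‖P (y - w)‖ := by
    intro y w
    rw [hNq, Seminorm.inf_apply, ← hcomp]
    exact ciInf_le (hbdd y) w
  have hPF2 : ∀ y ∈ F2, P y = y := fun y hy => Submodule.starProjection_eq_self_iff.2 (hF21 hy)
  have hlift : ∀ y ∈ F2, ∀ t, Nq y < t → ∃ z, P z = y ∧ NT z < t := by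
    intro y hy t ht
    rw [hNq, Seminorm.inf_apply] at ht
    obtain ⟨w, hw⟩ := exists_lt_of_ciInf_lt ht
    rw [hcomp] at hw
    obtain ⟨x, hx1, hx2⟩ := hA (P (y - w)) (by rw [hP]; exact Submodule.starProjection_apply_mem _ _) (t - NT w) (by
      have : B * ‖P (y - w)‖ < t - NT w := by linarith
      rw [hBdef, one_div, inv_mul_lt_iff₀ (by positivity)] at this
      exact this)
    refine ⟨w + x, ?_, ?_⟩
    · rw [map_add, hx1, map_sub, hPF2 y hy]; abel
    · have := map_add_le_add NT w x
      linarith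
  set ι : VV m →ₗ[ℝ] VV n := B⁻¹ • (F2.subtype ∘ₗ e.symm.toLinearEquiv.toLinearMap) with hι
  have hιa : ∀ u, ι u = B⁻¹ • ((e.symm u : F2) : VV n) := fun u => rfl
  have hιn : ∀ u, ‖ι u‖ = B⁻¹ * ‖u‖ := by
    intro u
    have h1 : ‖((e.symm u : F2) : VV n)‖ = ‖u‖ := e.symm.norm_map u
    rw [hιa, norm_smul, norm_inv, Real.norm_eq_abs, abs_of_pos hB0, h1]
  have hιm : ∀ u, ι u ∈ F2 := fun u => by rw [hιa]; exact F2.smul_mem _ (e.symm u).2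
  refine ⟨m, ?_, ?_, Nq.comp ι, ?_, ?_, ?_⟩
  · have := Submodule.finrank_le F2
    simpa using this
  · have h1 : n ≤ Module.finrank ℝ F1 + k := by simpa using hF1d
    omega
  · intro u
    have := hle (ι u) 0
    rw [sub_zero, hPF2 _ (hιm u), hιn, map_zero, zero_add, mul_inv_cancel_left₀ hB0.ne'] at this
    exact this
  · intro u
    have h1 : ∀ t, Nq (ι u) < t → ‖u‖ ≤ (2*δ/θ^2) * t := by
      intro t ht
      obtain ⟨z, hz1, hz2⟩ := hlift (ι u) (hιm u) t ht
      have h2 := hB z (by rw [hz1]; exact hιm u)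
      rw [hz1, hιn] at h2
      have h3 : θ * √n * (B⁻¹ * ‖u‖) = n * (θ^2 * ‖u‖) := by
        rw [hBdef, one_div, inv_inv]
        calc _ = (√n * √n) * (θ^2 * ‖u‖) := by ring
          _ = _ := by rw [hsq]
      rw [h3, mul_assoc] at h2
      have h4 := le_of_mul_le_mul_left h2 hnR
      have h5 : 2 * δ * NT z ≤ 2 * δ * t := by gcongr
      rw [div_mul_eq_mul_div, le_div_iff₀ (by positivity)]
      linarith
    have h2 : ∀ t, Nq (ι u) < t → ‖u‖ / (2*δ/θ^2) ≤ t := by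
      intro t ht
      rw [div_le_iff₀ (by positivity)]
      linarith [h1 t ht]
    have h3 := le_of_forall_gt_imp_ge_of_dense h2
    rw [div_le_iff₀ (by positivity)] at h3
    rw [Seminorm.comp_apply]
    linarith
  · intro M hM
    apply HasAnt.of_equiv N T Ti hT1 hT2
    let Z : Submodule ℝ (VV n) := F2.comap P.toLinearMap
    let q : Z →ₗ[ℝ] VV m := B • (e.toLinearEquiv.toLinearMap ∘ₗ
      (P.toLinearMap.restrict (p := Z) (q := F2) (fun x hx => hx)))
    have hq : ∀ z : Z, ι (q z) = P z := by
      intro z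
      rw [hιa]
      have : q z = B • e ⟨P z, z.2⟩ := rfl
      rw [this, map_smul, Submodule.coe_smul, smul_smul, inv_mul_cancel₀ hB0.ne', one_smul,
        LinearIsometryEquiv.symm_apply_apply]
    refine HasAnt.transfer NT (Nq.comp ι) Z q ?_ ?_ hM
    · intro z
      rw [Seminorm.comp_apply, hq]
      have := hle (P z) z
      rw [map_sub, hPF2 (P z) z.2, sub_self, norm_zero, mul_zero, add_zero] at this
      exact this
    · intro y hy
      obtain ⟨z, hz1, hz2⟩ := hlift (ι y) (hιm y) 1 hy
      have hzZ : z ∈ Z := by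
        change P z ∈ F2
        rw [hz1]; exact hιm y
      refine ⟨⟨z, hzZ⟩, ?_, hz2⟩
      have h1 : ι (q ⟨z, hzZ⟩) = ι y := by rw [hq]; exact hz1
      have h2 : ‖ι (q ⟨z, hzZ⟩ - y)‖ = 0 := by rw [map_sub, h1, sub_self, norm_zero]
      rw [hιn] at h2
      have h3 : ‖q ⟨z, hzZ⟩ - y‖ = 0 := by
        rcases mul_eq_zero.1 h2 with h | h
        · exact absurd h (inv_ne_zero hB0.ne')
        · exact h
      exact sub_eq_zero.1 (norm_eq_zero.1 h3)

end PF

section PG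

lemma iter (B : ℕ) (hB : 327 ≤ B) (n0 M : ℕ)
    (base : ∀ m, m ≤ n0 → n0 ≤ 2 * m → ∀ N : Seminorm ℝ (VV m), (∀ u, N u ≤ ‖u‖) →
      (∀ u, ‖u‖ ≤ 2 ^ (3 * B) * N u) → HasAnt N M) :
    ∀ i : ℕ, 8 * 2 ^ i ≤ n0 → ∀ m, m ≤ n0 → (n0 : ℝ) ≤ m + n0 / (2 * 2 ^ i) →
      ∀ N : Seminorm ℝ (VV m), (∀ u, N u ≤ ‖u‖) →
      (∀ u, ‖u‖ ≤ 2 ^ (3 * B * 2 ^ i) * N u) → HasAnt N M := by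
  intro i
  induction i with
  | zero =>
    intro _ m hm h N h1 h2
    refine base m hm ?_ N h1 (by simpa using h2)
    have : (n0 : ℝ) ≤ 2 * m := by norm_num at h; linarith
    exact_mod_cast this
  | succ i ih =>
    intro hi m hm h N h1 h2
    have hpi : 0 < 2 ^ i := by positivity
    have hi' : 8 * 2 ^ i ≤ n0 := by rw [pow_succ] at hi; omega
    set k := n0 / (8 * 2 ^ i) with hk
    have hk1 : 1 ≤ k := (Nat.one_le_div_iff (by positivity)).2 hi'
    have hk2 : k * (8 * 2 ^ i) ≤ n0 := Nat.div_mul_le_self _ _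
    have hk3 : n0 ≤ 16 * 2 ^ i * k := by
      have := Nat.lt_div_mul_add (a := n0) (b := 8 * 2 ^ i) (by positivity)
      rw [← hk] at this
      nlinarith
    set p := 10 * (16 * 2 ^ i) + 3 with hp
    have hm0 : 0 < m := by
      rcases Nat.eq_zero_or_pos m with h0 | h0
      · subst h0
        have hn : (0:ℝ) < n0 := by
          have : 0 < n0 := by omega
          exact_mod_cast this
        have h3 : (n0:ℝ) / (2 * 2 ^ (i+1)) ≤ n0 / 2 := by
          gcongr
          have : (1:ℝ) ≤ 2 ^ (i+1) := one_le_pow₀ (by norm_num)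
          linarith
        push_cast at h
        linarith
      · exact h0
    have hsmall : 768 ^ m * (3 * (1/2:ℝ)^p) ^ k < Real.exp (-(k/2)) := by
      have e1 : (768:ℝ) ^ m ≤ (2 ^ (10 * (16 * 2 ^ i))) ^ k := by
        calc (768:ℝ) ^ m ≤ 1024 ^ m := by gcongr; norm_num
          _ ≤ 1024 ^ (16 * 2 ^ i * k) := by gcongr; norm_num; omega
          _ = _ := by
            rw [show (1024:ℝ) = 2 ^ 10 by norm_num, ← pow_mul, ← pow_mul]; congr 1; ring
      have e2 : Real.exp (-((k:ℝ)/2)) = (Real.exp (-(1/2))) ^ k := by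
        rw [← Real.exp_nat_mul]; congr 1; ring
      rw [e2]
      calc 768 ^ m * (3 * (1/2:ℝ)^p) ^ k ≤ (2 ^ (10 * (16 * 2 ^ i))) ^ k * (3 * (1/2:ℝ)^p) ^ k := by gcongr
        _ = (3/8) ^ k := by
          rw [← mul_pow]; congr 1
          rw [hp, pow_add]
          have : (2:ℝ) ^ (10 * (16 * 2 ^ i)) * (1/2) ^ (10 * (16 * 2 ^ i)) = 1 := by
            rw [← mul_pow]; norm_num
          calc _ = ((2:ℝ) ^ (10 * (16 * 2 ^ i)) * (1/2) ^ (10 * (16 * 2 ^ i))) * (3 * (1/2)^3) := by ring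
            _ = _ := by rw [this]; norm_num
        _ < _ := by
          apply pow_lt_pow_left₀ _ (by norm_num) (by omega)
          have := Real.add_one_le_exp (-(1/2:ℝ))
          linarith
    set δ : ℝ := 2 ^ (2 * B * 2 ^ i) with hδ
    obtain ⟨m', hm'1, hm'2, N', hN1, hN2, hN3⟩ := step hm0 N δ (one_le_pow₀ (by norm_num)) h1 (by
      intro u
      refine (h2 u).trans (le_of_eq ?_)
      congr 1
      rw [hδ, ← pow_mul]; congr 1; ring) k ((1/2)^p) (by positivity) (by
        calc ((1/2:ℝ)^p) ≤ (1/2)^1 := pow_le_pow_of_le_one (by norm_num) (by norm_num) (by omega)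
          _ = _ := by norm_num) hsmall
    refine hN3 M (ih hi' m' (by omega) ?_ N' hN1 ?_)
    · have e1 : (m : ℝ) ≤ m' + 2 * k := by exact_mod_cast hm'2
      have e2 : (k:ℝ) * (8 * 2 ^ i) ≤ n0 := by exact_mod_cast hk2
      have e3 : (k:ℝ) ≤ n0 / (8 * 2 ^ i) := (le_div_iff₀ (by positivity)).2 e2
      have e4 : (n0:ℝ) / (2 * 2 ^ (i+1)) + 2 * (n0 / (8 * 2 ^ i)) = n0 / (2 * 2 ^ i) := by
        rw [pow_succ]; field_simp; ring
      linarith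
    · intro u
      refine (hN2 u).trans ?_
      gcongr
      calc 2 * δ / ((1/2)^p)^2 = 2 ^ (1 + 2 * B * 2 ^ i + p * 2) := by
            rw [hδ, div_eq_iff (by positivity), ← pow_mul, pow_add _ _ (p*2), mul_assoc (_ ^ _), ← mul_pow, pow_add]; norm_num
        _ ≤ _ := by
          gcongr
          · norm_num
          · rw [hp]; nlinarith

lemma start (B : ℕ) (hB : 327 ≤ B) (n0 M : ℕ) (hn : 8 ≤ n0)
    (base : ∀ m, m ≤ n0 → n0 ≤ 2 * m → ∀ N : Seminorm ℝ (VV m), (∀ u, N u ≤ ‖u‖) →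
      (∀ u, ‖u‖ ≤ 2 ^ (3 * B) * N u) → HasAnt N M)
    (N : Seminorm ℝ (VV n0)) (C : ℝ) (hC : ∀ u, ‖u‖ ≤ C * N u) : HasAnt N M := by
  classical
  obtain ⟨T, Ti, hT1, hT2, hT3, hT4⟩ := ell_pos N C hC
  have hn0 : (0:ℝ) < n0 := by have : 0 < n0 := by omega
                              exact_mod_cast this
  have hcol : ∀ i, N (T (EuclideanSpace.single i 1)) ≤ 1 := by
    intro i
    refine le_trans (le_trans (col_le_ell N (fun i => T (EuclideanSpace.single i (1:ℝ))) i) ?_) hT3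
    unfold ell
    apply Ex_mono
    intro ε
    have e : sv ε = ∑ i, sg (ε i) • EuclideanSpace.single i (1:ℝ) := by
      ext j; simp [Finset.sum_apply, Pi.single_apply, sv_apply]
    rw [e, map_sum T]
    simp
  have hup : ∀ u, N (T u) ≤ n0 * ‖u‖ := by
    intro u
    have e : u = ∑ i, u i • EuclideanSpace.single i (1:ℝ) := by
      ext j; simp [Finset.sum_apply, Pi.single_apply]
    have h1 : T u = ∑ i, u i • T (EuclideanSpace.single i 1) := by
      conv_lhs => rw [e]
      simp
    rw [h1]
    refine (semi_sum N _ _).trans ?_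
    calc ∑ i, N (u i • T (EuclideanSpace.single i 1)) ≤ ∑ i : Fin n0, ‖u‖ := by
          apply Finset.sum_le_sum
          intro i _
          rw [map_smul_eq_mul]
          have := PiLp.norm_apply_le u i
          have h0 : 0 ≤ N (T (EuclideanSpace.single i 1)) := apply_nonneg _ _
          have := hcol i
          have := norm_nonneg (u i)
          nlinarith
      _ = _ := by simp
  have hcoord : ∀ x i, |Ti x i| ≤ n0 * N x := by
    have h1 : ∀ x i, Ti x i ≤ n0 * N x := by
      intro x i
      have := hT4 (Pi.single i x)
      rw [Finset.sum_eq_single i (by intro j _ hj; simp [Pi.single_eq_of_ne hj]) (by simp)] at this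
      rw [Pi.single_eq_same] at this
      refine this.trans (le_of_eq ?_)
      congr 1
      rw [← Ex_const (n := n0) (N x)]
      congr 1; ext ε
      rw [Finset.sum_eq_single i (by intro j _ hj; simp [Pi.single_eq_of_ne hj]) (by simp)]
      rw [Pi.single_eq_same, map_smul_eq_mul, Real.norm_eq_abs, sg_abs, one_mul]
    intro x i
    rw [abs_le]
    refine ⟨?_, h1 x i⟩
    have := h1 (-x) i
    simp at this
    linarith
  have hlow : ∀ u, ‖u‖ ≤ n0 * (n0 * N (T u)) := by
    intro u
    have e : u = ∑ i, u i • EuclideanSpace.single i (1:ℝ) := by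
      ext j; simp [Finset.sum_apply, Pi.single_apply]
    calc ‖u‖ = ‖∑ i, u i • EuclideanSpace.single i (1:ℝ)‖ := by rw [← e]
      _ ≤ ∑ i, ‖u i • EuclideanSpace.single i (1:ℝ)‖ := norm_sum_le _ _
      _ ≤ ∑ i : Fin n0, n0 * N (T u) := by
        apply Finset.sum_le_sum
        intro i _
        rw [norm_smul]
        have := hcoord (T u) i
        rw [hT2] at this
        simpa using this
      _ = _ := by simp
  apply HasAnt.of_equiv N ((n0:ℝ)⁻¹ • T) ((n0:ℝ) • Ti)
    (by intro x; simp [hT1, hn0.ne']) (by intro x; simp [hT2, hn0.ne'])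
  have hNc : ∀ u, (N.comp ((n0:ℝ)⁻¹ • T)) u = (n0:ℝ)⁻¹ * N (T u) := by
    intro u
    rw [Seminorm.comp_apply, LinearMap.smul_apply, map_smul_eq_mul, norm_inv, Real.norm_eq_abs, abs_of_pos hn0]
  set I := Nat.log 2 (n0 / 8) with hI
  have hI1 : 8 * 2 ^ I ≤ n0 := by
    have := Nat.pow_log_le_self 2 (x := n0/8) (by omega)
    rw [← hI] at this
    omega
  have hI2 : n0 ≤ 16 * 2 ^ I := by
    have := Nat.lt_pow_succ_log_self (b := 2) (by norm_num) (n0/8)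
    rw [← hI, pow_succ] at this
    omega
  refine iter B hB n0 M base I hI1 n0 le_rfl ?_ _ ?_ ?_
  · have : 0 ≤ (n0:ℝ) / (2 * 2 ^ I) := by positivity
    linarith
  · intro u
    rw [hNc, inv_mul_le_iff₀ hn0]
    exact hup u
  · intro u
    rw [hNc]
    have h1 : n0 ≤ 2 ^ (B * 2 ^ I) := by
      calc n0 ≤ 16 * 2 ^ I := hI2
        _ = 2 ^ (4 + I) := by rw [pow_add]; norm_num
        _ ≤ _ := by
          apply Nat.pow_le_pow_right (by norm_num)
          have : I < 2 ^ I := Nat.lt_two_pow_self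
          nlinarith
    have h2 : (n0:ℝ) ≤ 2 ^ (B * 2 ^ I) := by exact_mod_cast h1
    have h3 : (n0:ℝ)^3 ≤ 2 ^ (3 * B * 2 ^ I) := by
      calc (n0:ℝ)^3 ≤ (2 ^ (B * 2 ^ I))^3 := by gcongr
        _ = _ := by rw [← pow_mul]; congr 1; ring
    have h4 : 0 ≤ (n0:ℝ)⁻¹ * N (T u) := mul_nonneg (by positivity) (apply_nonneg _ _)
    calc ‖u‖ ≤ n0 * (n0 * N (T u)) := hlow u
      _ = (n0:ℝ)^3 * ((n0:ℝ)⁻¹ * N (T u)) := by field_simp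
      _ ≤ _ := by gcongr

end PG

section PH

def KK : ℕ → Type
  | 0 => Bool
  | j+1 => KK j × KK j

instance KKfin : ∀ j, Fintype (KK j)
  | 0 => inferInstanceAs (Fintype Bool)
  | j+1 => @instFintypeProd _ _ (KKfin j) (KKfin j)

instance KKne : ∀ j, Nonempty (KK j)
  | 0 => inferInstanceAs (Nonempty Bool)
  | j+1 => ⟨((KKne j).some, (KKne j).some)⟩

def yy : ∀ j, KK j → ℝ
  | 0 => fun b => sg b
  | j+1 => fun p => (yy j p.1 - yy j p.2) / √2

lemma KK_card_succ (j : ℕ) : Fintype.card (KK (j+1)) = Fintype.card (KK j) * Fintype.card (KK j) :=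
  Fintype.card_prod (KK j) (KK j)

lemma KK_sum_zero (h : KK 0 → ℝ) : ∑ p, h p = h true + h false := Fintype.sum_bool h

lemma KK_sum_succ (j : ℕ) (h : KK (j+1) → ℝ) : ∑ p, h p = ∑ p : KK j, ∑ q : KK j, h (p, q) :=
  Fintype.sum_prod_type (α₁ := KK j) (α₂ := KK j) h

lemma KK_mgf (j : ℕ) (s : ℝ) : ∑ p, Real.exp (s * yy j p) ≤ Fintype.card (KK j) * Real.exp (s^2/2) := by
  induction j generalizing s with
  | zero =>
    rw [KK_sum_zero]
    have h := Real.cosh_le_exp_half_sq s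
    have e : Fintype.card (KK 0) = 2 := Fintype.card_bool
    have e1 : yy 0 true = 1 := sg_true
    have e2 : yy 0 false = -1 := sg_false
    rw [e, e1, e2]
    rw [Real.cosh_eq] at h
    push_cast
    simp only [mul_one, mul_neg]
    linarith
  | succ j ih =>
    rw [KK_sum_succ]
    have h2 : (√2:ℝ)^2 = 2 := Real.sq_sqrt (by norm_num)
    have e : ∀ p q : KK j, Real.exp (s * yy (j+1) (p, q)) =
        Real.exp ((s/√2) * yy j p) * Real.exp ((-s/√2) * yy j q) := by
      intro p q
      rw [← Real.exp_add]
      congr 1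
      change s * ((yy j p - yy j q) / √2) = _
      ring
    simp only [e]
    rw [← Fintype.sum_mul_sum, KK_card_succ]
    have h3 := ih (s/√2)
    have h4 := ih (-s/√2)
    rw [div_pow, h2] at h3 h4
    rw [neg_sq] at h4
    calc _ ≤ (Fintype.card (KK j) * Real.exp (s^2/2/2)) * (Fintype.card (KK j) * Real.exp (s^2/2/2)) := by
          gcongr
      _ = Fintype.card (KK j) * Fintype.card (KK j) * (Real.exp (s^2/2/2) * Real.exp (s^2/2/2)) := by ring
      _ = _ := by rw [← Real.exp_add]; push_cast; congr 2; ring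

lemma KK_mom (j : ℕ) : ∑ p, yy j p = 0 ∧ ∑ p, (yy j p)^2 = Fintype.card (KK j) ∧
    ∑ p, (yy j p)^4 ≤ 3 * Fintype.card (KK j) := by
  induction j with
  | zero =>
    have e : Fintype.card (KK 0) = 2 := Fintype.card_bool
    have e1 : yy 0 true = 1 := sg_true
    have e2 : yy 0 false = -1 := sg_false
    simp only [KK_sum_zero, e, e1, e2]
    norm_num
  | succ j ih =>
    obtain ⟨h1, h2, h4⟩ := ih
    have hs2 : (√2:ℝ)^2 = 2 := Real.sq_sqrt (by norm_num)
    have hs4 : (√2:ℝ)^4 = 4 := by rw [show 4 = 2 * 2 by rfl, pow_mul, hs2]; norm_num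
    have e : ∀ p q : KK j, yy (j+1) (p, q) = (yy j p - yy j q) / √2 := fun _ _ => rfl
    simp only [KK_sum_succ, e, KK_card_succ, div_pow, hs2, hs4]
    set K : ℝ := (Fintype.card (KK j) : ℝ) with hK
    have hK0 : 0 ≤ K := by positivity
    have x2 : ∀ p q : KK j, (yy j p - yy j q)^2/2 = (1/2) * yy j p^2 - yy j p * yy j q + (1/2) * yy j q^2 := by
      intros; ring
    have x4 : ∀ p q : KK j, (yy j p - yy j q)^4/4 = (1/4) * yy j p^4 - yy j p^3 * yy j q
      + ((3/2) * yy j p^2) * yy j q^2 - yy j p * yy j q^3 + (1/4) * yy j q^4 := by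
      intros; ring
    refine ⟨?_, ?_, ?_⟩
    · simp [← Finset.sum_div, Finset.sum_sub_distrib, h1, ← Finset.mul_sum]
    · simp only [x2, Finset.sum_add_distrib, Finset.sum_sub_distrib, ← Finset.mul_sum, h1, h2]
      simp only [Finset.sum_const, Finset.card_univ, nsmul_eq_mul, ← hK, ← Finset.mul_sum, h2]
      push_cast
      simp
      ring
    · simp only [x4, Finset.sum_add_distrib, Finset.sum_sub_distrib, ← Finset.mul_sum, ← Finset.sum_mul, h1, h2]
      simp only [Finset.sum_const, Finset.card_univ, nsmul_eq_mul, ← hK, ← Finset.mul_sum, h2]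
      push_cast
      rw [← hK]
      nlinarith

def XX {m : ℕ} (j : ℕ) (ω : Fin m → KK j) : VV m := WithLp.toLp 2 (fun i => yy j (ω i))

lemma prod_sum_KK {m j : ℕ} (g : Fin m → KK j → ℝ) :
    ∑ ω : Fin m → KK j, ∏ i, g i (ω i) = ∏ i, ∑ p, g i p := by
  classical
  rw [Finset.prod_univ_sum, Fintype.piFinset_univ]

lemma XX_mgf {m : ℕ} (j : ℕ) (f : VV m) : ∑ ω : Fin m → KK j, Real.exp (inner ℝ f (XX j ω)) ≤
    Fintype.card (Fin m → KK j) * Real.exp (‖f‖^2/2) := by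
  classical
  have e : ∀ ω : Fin m → KK j, Real.exp (inner ℝ f (XX j ω)) = ∏ i, Real.exp (f i * yy j (ω i)) := by
    intro ω
    rw [← Real.exp_sum]
    congr 1
    simp [PiLp.inner_apply, XX, mul_comm]
  simp only [e]
  rw [prod_sum_KK (fun i p => Real.exp (f i * yy j p))]
  calc _ ≤ ∏ i : Fin m, (Fintype.card (KK j) * Real.exp ((f i)^2/2)) := by
        apply Finset.prod_le_prod
        · intro i _; positivity
        · intro i _; exact KK_mgf j (f i)
    _ = _ := by
      rw [Finset.prod_mul_distrib, ← Real.exp_sum, EuclideanSpace.real_norm_sq_eq, Finset.sum_div]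
      simp

lemma XX_tail {m : ℕ} (j : ℕ) (f : VV m) (hf : ‖f‖ ≤ 1) (t : ℝ) (ht : 0 ≤ t) :
    ((Finset.univ.filter (fun ω : Fin m → KK j => t < inner ℝ f (XX j ω))).card : ℝ) ≤
      Fintype.card (Fin m → KK j) * Real.exp (-(t^2/2)) := by
  classical
  have h := XX_mgf j (t • f)
  have h1 : ((Finset.univ.filter (fun ω : Fin m → KK j => t < inner ℝ f (XX j ω))).card : ℝ) * Real.exp (t^2)
      ≤ ∑ ω : Fin m → KK j, Real.exp (inner ℝ (t • f) (XX j ω)) := by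
    rw [← nsmul_eq_mul, ← Finset.sum_const]
    refine le_trans (Finset.sum_le_sum ?_) (Finset.sum_le_sum_of_subset_of_nonneg (Finset.filter_subset _ _)
      (fun _ _ _ => (Real.exp_pos _).le))
    intro ω hω
    rw [Finset.mem_filter] at hω
    apply Real.exp_le_exp.2
    rw [real_inner_smul_left]
    nlinarith [hω.2]
  have h2 : Real.exp (‖t • f‖^2/2) ≤ Real.exp (t^2/2) := by
    apply Real.exp_le_exp.2
    rw [norm_smul, Real.norm_eq_abs, mul_pow, sq_abs]
    have : ‖f‖^2 ≤ 1 := by nlinarith [norm_nonneg f]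
    nlinarith [sq_nonneg t]
  have h3 : Real.exp (-(t^2/2)) * Real.exp (t^2) = Real.exp (t^2/2) := by
    rw [← Real.exp_add]; congr 1; ring
  have h4 : (0:ℝ) < Real.exp (t^2) := Real.exp_pos _
  rw [← mul_le_mul_iff_left₀ h4, mul_assoc, h3]
  refine h1.trans (h.trans ?_)
  gcongr

lemma XX_small {m : ℕ} (j : ℕ) :
    ((Finset.univ.filter (fun ω : Fin m → KK j => ‖XX j ω‖^2 ≤ m/4)).card : ℝ) ≤
      Fintype.card (Fin m → KK j) * (9/10) ^ m := by
  classical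
  have e : ∀ ω : Fin m → KK j, Real.exp (-(1/4) * ‖XX j ω‖^2) = ∏ i, Real.exp (-(1/4) * (yy j (ω i))^2) := by
    intro ω
    rw [← Real.exp_sum, ← Finset.mul_sum, EuclideanSpace.real_norm_sq_eq]
    rfl
  have hexp : ∀ x : ℝ, 0 ≤ x → Real.exp (-x) ≤ 1 - x + x^2/2 := by
    intro x hx
    have h1 := Real.quadratic_le_exp_of_nonneg hx
    rw [Real.exp_neg]
    have h0 : 0 < 1 + x + x^2/2 := by positivity
    have h2 : (Real.exp x)⁻¹ ≤ (1 + x + x^2/2)⁻¹ := by gcongr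
    refine h2.trans ?_
    rw [inv_le_iff_one_le_mul₀ h0]
    nlinarith [sq_nonneg (x^2)]
  have h1 : ∑ p, Real.exp (-(1/4) * (yy j p)^2) ≤ Fintype.card (KK j) * (27/32) := by
    obtain ⟨_, h2, h4⟩ := KK_mom j
    calc _ ≤ ∑ p, (1 - (1/4) * (yy j p)^2 + (1/32) * (yy j p)^4) := by
          apply Finset.sum_le_sum
          intro p _
          have := hexp ((1/4) * (yy j p)^2) (by positivity)
          rw [neg_mul]
          refine this.trans (le_of_eq ?_)
          ring
      _ ≤ _ := by
        rw [Finset.sum_add_distrib, Finset.sum_sub_distrib, ← Finset.mul_sum, ← Finset.mul_sum, h2]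
        simp
        linarith
  have h2 : ∑ ω : Fin m → KK j, Real.exp (-(1/4) * ‖XX j ω‖^2) ≤ (Fintype.card (KK j) * (27/32)) ^ m := by
    simp only [e]
    rw [prod_sum_KK (fun i p => Real.exp (-(1/4) * (yy j p)^2))]
    simp only [Finset.prod_const, Finset.card_univ, Fintype.card_fin]
    gcongr
  have h3 : ((Finset.univ.filter (fun ω : Fin m → KK j => ‖XX j ω‖^2 ≤ m/4)).card : ℝ) * (15/16)^m ≤
      ∑ ω : Fin m → KK j, Real.exp (-(1/4) * ‖XX j ω‖^2) := by
    rw [← nsmul_eq_mul, ← Finset.sum_const]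
    refine le_trans (Finset.sum_le_sum ?_) (Finset.sum_le_sum_of_subset_of_nonneg (Finset.filter_subset _ _)
      (fun _ _ _ => (Real.exp_pos _).le))
    intro ω hω
    rw [Finset.mem_filter] at hω
    have h5 := hω.2
    calc ((15:ℝ)/16)^m ≤ (Real.exp (-(1/16))) ^ m := by
          gcongr
          have := Real.add_one_le_exp (-(1/16:ℝ))
          linarith
      _ = Real.exp (m * (-(1/16))) := by rw [Real.exp_nat_mul]
      _ ≤ _ := by
        apply Real.exp_le_exp.2
        linarith
  have h4 : (0:ℝ) < (15/16)^m := by positivity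
  rw [← mul_le_mul_iff_left₀ h4]
  refine h3.trans (h2.trans (le_of_eq ?_))
  have h5 : (Fintype.card (Fin m → KK j) : ℝ) = (Fintype.card (KK j) : ℝ) ^ m := by simp
  rw [h5, mul_pow, mul_assoc, ← mul_pow (9/10:ℝ)]
  congr 1
  norm_num

lemma XX_zero_norm {m : ℕ} (ω : Fin m → KK 0) : ‖XX 0 ω‖ = √m := by
  rw [EuclideanSpace.norm_eq]
  congr 1
  have : ∀ i, ‖XX 0 ω i‖^2 = 1 := by
    intro i
    have : ‖XX 0 ω i‖ = 1 := sg_abs (ω i)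
    rw [this]; norm_num
  rw [Finset.sum_congr rfl (fun i _ => this i)]
  simp

lemma XX_succ {m j : ℕ} (ω ω' : Fin m → KK j) :
    XX j ω - XX j ω' = √2 • XX (j+1) (fun i => ((ω i, ω' i) : KK j × KK j)) := by
  ext i
  change yy j (ω i) - yy j (ω' i) = √2 * ((yy j (ω i) - yy j (ω' i)) / √2)
  field_simp

def bcount {m : ℕ} (N : Seminorm ℝ (VV m)) (j : ℕ) (r : ℝ) : ℕ := by
  classical
  exact (Finset.univ.filter (fun ω : Fin m → KK j => N (XX j ω) ≤ r)).card

lemma bcount_pairs {m j : ℕ} (N : Seminorm ℝ (VV m)) (r : ℝ) [DecidablePred fun p : (Fin m → KK j) × (Fin m → KK j) => N (XX j p.1 - XX j p.2) ≤ √2 * r] :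
    (Finset.univ.filter (fun p : (Fin m → KK j) × (Fin m → KK j) =>
      N (XX j p.1 - XX j p.2) ≤ √2 * r)).card = bcount N (j+1) r := by
  classical
  unfold bcount
  refine Finset.card_equiv (Equiv.arrowProdEquivProdArrow (Fin m) (fun _ => KK j) (fun _ => KK j)).symm ?_
  rintro ⟨ω, ω'⟩
  simp only [Finset.mem_filter, Finset.mem_univ, true_and]
  rw [XX_succ, map_smul_eq_mul, Real.norm_eq_abs, abs_of_pos (by positivity)]
  have h2 : 0 < √(2:ℝ) := by positivity
  rw [mul_le_mul_iff_right₀ h2]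
  rfl

end PH

section PI

lemma tuple_inj {α β A : Type*} [Fintype α] [Fintype β] [Fintype A] [DecidableEq α] [DecidableEq β]
    (σ : α → β) (hσ : Function.Injective σ) (P : (α → A) → Prop) [DecidablePred P] :
    (Finset.univ.filter (fun x : β → A => P (x ∘ σ))).card * Fintype.card A ^ Fintype.card α ≤
      Fintype.card A ^ Fintype.card β * (Finset.univ.filter P).card := by
  classical
  have e1 : Fintype.card A ^ Fintype.card α = (Finset.univ : Finset (α → A)).card := by simp
  have e2 : Fintype.card A ^ Fintype.card β = (Finset.univ : Finset (β → A)).card := by simp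
  rw [e1, e2, ← Finset.card_product, ← Finset.card_product]
  apply Finset.card_le_card_of_injOn (fun z => (Function.extend σ z.2 z.1, z.1 ∘ σ))
  · rintro ⟨x, p⟩ h
    simp at h ⊢
    exact h
  · rintro ⟨x, p⟩ _ ⟨x', p'⟩ _ h
    simp only [Prod.mk.injEq] at h ⊢
    obtain ⟨h1, h2⟩ := h
    have hp : p = p' := by
      ext a
      have := congrFun h1 (σ a)
      rwa [hσ.extend_apply, hσ.extend_apply] at this
    refine ⟨?_, hp⟩
    ext b
    by_cases hb : ∃ a, σ a = b
    · obtain ⟨a, rfl⟩ := hb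
      exact congrFun h2 a
    · have := congrFun h1 b
      rwa [Function.extend_apply' _ _ _ hb, Function.extend_apply' _ _ _ hb] at this

lemma tuple_exists {A : Type*} [Fintype A] [Nonempty A] (P : (Fin 2 → A) → Prop) (Q : (Fin 3 → A) → Prop)
    [DecidablePred P] [DecidablePred Q]
    (M : ℕ) (β2 β3 : ℝ) (h2 : ((Finset.univ.filter P).card : ℝ) ≤ β2 * (Fintype.card A)^2)
    (h3 : ((Finset.univ.filter Q).card : ℝ) ≤ β3 * (Fintype.card A)^3)
    (h : (M:ℝ)^2 * β2 + M^3 * β3 < 1) :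
    ∃ x : Fin M → A, (∀ i j, i ≠ j → ¬ P ![x i, x j]) ∧
      ∀ i j l, i ≠ j → l ≠ i → l ≠ j → ¬ Q ![x i, x j, x l] := by
  classical
  by_contra hcon
  push Not at hcon
  set K : ℝ := (Fintype.card A : ℝ) with hK
  have hK0 : 0 < K := by rw [hK]; exact_mod_cast Fintype.card_pos
  set B2 : Fin M × Fin M → Finset (Fin M → A) := fun p =>
    Finset.univ.filter (fun x => p.1 ≠ p.2 ∧ P (x ∘ ![p.1, p.2])) with hB2
  set B3 : Fin M × Fin M × Fin M → Finset (Fin M → A) := fun p =>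
    Finset.univ.filter (fun x => (p.1 ≠ p.2.1 ∧ p.2.2 ≠ p.1 ∧ p.2.2 ≠ p.2.1) ∧ Q (x ∘ ![p.1, p.2.1, p.2.2])) with hB3
  have hβ2 : 0 ≤ β2 := by
    by_contra hc
    push Not at hc
    have : (0:ℝ) ≤ (Finset.univ.filter P).card := by positivity
    nlinarith [pow_pos hK0 2]
  have hβ3 : 0 ≤ β3 := by
    by_contra hc
    push Not at hc
    have : (0:ℝ) ≤ (Finset.univ.filter Q).card := by positivity
    nlinarith [pow_pos hK0 3]
  have c2 : ∀ p, ((B2 p).card : ℝ) ≤ K^M * β2 := by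
    intro p
    by_cases hp : p.1 ≠ p.2
    · have hinj : Function.Injective ![p.1, p.2] := by
        intro a b hab
        fin_cases a <;> fin_cases b <;> simp_all
      have h1 := tuple_inj ![p.1, p.2] hinj P
      have h4 : ((Finset.univ.filter (fun x : Fin M → A => P (x ∘ ![p.1, p.2]))).card : ℝ) * K^2 ≤
        K^M * (Finset.univ.filter P).card := by
        have : _ := (Nat.cast_le (α := ℝ)).2 h1
        push_cast at this
        simpa using this
      have e : B2 p = Finset.univ.filter (fun x : Fin M → A => P (x ∘ ![p.1, p.2])) := by
        rw [hB2]; ext x; simp [hp]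
      rw [e]
      have h5 : 0 < K^2 := by positivity
      rw [← mul_le_mul_iff_left₀ h5]
      refine h4.trans ?_
      rw [mul_assoc]
      gcongr
    · have e : B2 p = ∅ := by rw [hB2]; ext x; simp [not_not.1 hp]
      rw [e]; simp; positivity
  have c3 : ∀ p, ((B3 p).card : ℝ) ≤ K^M * β3 := by
    intro p
    by_cases hp : (p.1 ≠ p.2.1 ∧ p.2.2 ≠ p.1 ∧ p.2.2 ≠ p.2.1)
    · have hinj : Function.Injective ![p.1, p.2.1, p.2.2] := by
        obtain ⟨hp1, hp2, hp3⟩ := hp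
        intro a b hab
        fin_cases a <;> fin_cases b <;> simp at hab ⊢
        all_goals first | exact hp1 hab | exact hp2 hab | exact hp3 hab | exact hp1 hab.symm | exact hp2 hab.symm | exact hp3 hab.symm
      have h1 := tuple_inj ![p.1, p.2.1, p.2.2] hinj Q
      have h4 : ((Finset.univ.filter (fun x : Fin M → A => Q (x ∘ ![p.1, p.2.1, p.2.2]))).card : ℝ) * K^3 ≤
        K^M * (Finset.univ.filter Q).card := by
        have : _ := (Nat.cast_le (α := ℝ)).2 h1
        push_cast at this
        simpa using this
      have e : B3 p = Finset.univ.filter (fun x : Fin M → A => Q (x ∘ ![p.1, p.2.1, p.2.2])) := by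
        rw [hB3]; ext x; simp [hp]
      rw [e]
      have h5 : 0 < K^3 := by positivity
      rw [← mul_le_mul_iff_left₀ h5]
      refine h4.trans ?_
      rw [mul_assoc]
      gcongr
    · have e : B3 p = ∅ := by rw [hB3]; ext x; simp only [hp]; simp
      rw [e]; simp; positivity
  have hcov : (Finset.univ : Finset (Fin M → A)) ⊆ Finset.univ.biUnion B2 ∪ Finset.univ.biUnion B3 := by
    intro x _
    rw [Finset.mem_union, Finset.mem_biUnion, Finset.mem_biUnion]
    by_cases hx : ∀ i j, i ≠ j → ¬ P ![x i, x j]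
    · right
      obtain ⟨i, j, l, a, b, c, d⟩ := hcon x hx
      refine ⟨(i, j, l), Finset.mem_univ _, ?_⟩
      rw [hB3]
      simp only [Finset.mem_filter, Finset.mem_univ, true_and]
      refine ⟨⟨a, b, c⟩, ?_⟩
      convert d using 1
      ext t; fin_cases t <;> rfl
    · left
      push Not at hx
      obtain ⟨i, j, a, d⟩ := hx
      refine ⟨(i, j), Finset.mem_univ _, ?_⟩
      rw [hB2]
      simp only [Finset.mem_filter, Finset.mem_univ, true_and]
      refine ⟨a, ?_⟩
      convert d using 1
      ext t; fin_cases t <;> rfl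
  have hc := (Finset.card_le_card hcov).trans (Finset.card_union_le _ _)
  have hc2 := hc.trans (add_le_add (Finset.card_biUnion_le) (Finset.card_biUnion_le))
  have hc3 : K^M ≤ ∑ p, ((B2 p).card : ℝ) + ∑ p, ((B3 p).card : ℝ) := by
    have : _ := (Nat.cast_le (α := ℝ)).2 hc2
    push_cast at this
    simpa using this
  have s2 : ∑ p, ((B2 p).card : ℝ) ≤ M^2 * (K^M * β2) := by
    refine (Finset.sum_le_sum fun p _ => c2 p).trans (le_of_eq ?_)
    rw [Finset.sum_const, nsmul_eq_mul, Finset.card_univ, Fintype.card_prod, Fintype.card_fin]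
    push_cast; ring
  have s3 : ∑ p, ((B3 p).card : ℝ) ≤ M^3 * (K^M * β3) := by
    refine (Finset.sum_le_sum fun p _ => c3 p).trans (le_of_eq ?_)
    rw [Finset.sum_const, nsmul_eq_mul, Finset.card_univ, Fintype.card_prod, Fintype.card_prod, Fintype.card_fin]
    push_cast; ring
  have : 0 < K^M := by positivity
  nlinarith

end PI

section PJ

lemma hb_vec {m : ℕ} (N : Seminorm ℝ (VV m)) (hN : ∀ u, N u ≤ ‖u‖) (v : VV m) :
    ∃ g : VV m, ‖g‖ ≤ 1 ∧ (∀ u, (inner ℝ g u : ℝ) ≤ N u) ∧ (inner ℝ g v : ℝ) = N v := by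
  have hlin : ∃ f : VV m →ₗ[ℝ] ℝ, (∀ u, f u ≤ N u) ∧ f v = N v := by
    by_cases hv : v = 0
    · refine ⟨0, fun u => by simp, by simp [hv]⟩
    · obtain ⟨g, hg1, hg2⟩ := exists_extension_of_le_sublinear
        (LinearPMap.mkSpanSingleton v (N v) hv : VV m →ₗ.[ℝ] ℝ) N
        (fun c hc x => by rw [map_smul_eq_mul, Real.norm_eq_abs, abs_of_pos hc])
        (fun x y => map_add_le_add N x y) (by
          rintro ⟨x, hx⟩
          obtain ⟨c, rfl⟩ := Submodule.mem_span_singleton.1 hx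
          rw [LinearPMap.mkSpanSingleton'_apply]
          simp only [RingHom.id_apply, smul_eq_mul, map_smul_eq_mul, Real.norm_eq_abs]
          have : 0 ≤ N v := apply_nonneg _ _
          gcongr
          exact le_abs_self c)
      refine ⟨g, hg2, ?_⟩
      have h1 := hg1 ⟨v, Submodule.mem_span_singleton_self v⟩
      exact h1.trans (LinearPMap.mkSpanSingleton_apply ℝ ℝ hv (N v))
  obtain ⟨f, hf1, hf2⟩ := hlin
  obtain ⟨g, hg⟩ : ∃ g : VV m, ∀ x, f x = inner ℝ g x :=
    ⟨(InnerProductSpace.toDual ℝ (VV m)).symm f.toContinuousLinearMap, fun x => by simp⟩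
  refine ⟨g, ?_, fun u => by rw [← hg]; exact hf1 u, by rw [← hg]; exact hf2⟩
  have h1 : (inner ℝ g g : ℝ) ≤ ‖g‖ := by rw [← hg]; exact (hf1 g).trans (hN g)
  rw [real_inner_self_eq_norm_sq] at h1
  by_contra hc
  push Not at hc
  nlinarith

lemma level {m j : ℕ} (N : Seminorm ℝ (VV m)) (hN : ∀ u, N u ≤ ‖u‖) (r s : ℝ) (hr : 0 < r) (M : ℕ)
    (h1 : Real.exp (-s) * Fintype.card (Fin m → KK j) ≤ bcount N j r)
    (h2 : (bcount N (j+1) (8/10 * r) : ℝ) ≤ Real.exp (-(4*s)) * (Fintype.card (Fin m → KK j))^2)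
    (h3 : 5 * s ≤ (r/10)^2/2) (h4 : 2 ≤ s) (hM : (M:ℝ) ≤ Real.exp (s/2)) : HasAnt N M := by
  classical
  set Ω : ℝ := (Fintype.card (Fin m → KK j) : ℝ) with hΩ
  have hΩ0 : 0 < Ω := by rw [hΩ]; exact_mod_cast Fintype.card_pos
  let A := {ω : Fin m → KK j // N (XX j ω) ≤ r}
  have hA : Fintype.card A = bcount N j r := by
    unfold bcount
    rw [Fintype.card_subtype]
  have hbp : (0:ℝ) < bcount N j r := lt_of_lt_of_le (by positivity) h1
  have hne : Nonempty A := by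
    rw [← Fintype.card_pos_iff, hA]
    exact_mod_cast hbp
  set K : ℝ := (Fintype.card A : ℝ) with hK
  have hKb : K = bcount N j r := by rw [hK, hA]
  rw [← hKb] at h1 hbp
  choose g hg1 hg2 hg3 using fun v => hb_vec N hN v
  have hE : Ω ≤ Real.exp s * K := by
    have : Real.exp s * (Real.exp (-s) * Ω) ≤ Real.exp s * K := by gcongr
    rwa [← mul_assoc, ← Real.exp_add, add_neg_cancel, Real.exp_zero, one_mul] at this
  let P : (Fin 2 → A) → Prop := fun p => N (XX j (p 0).1 - XX j (p 1).1) ≤ √2 * (8/10 * r)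
  let Q : (Fin 3 → A) → Prop := fun p =>
    r/10 < |(inner ℝ (g (XX j (p 0).1 - XX j (p 1).1)) (XX j (p 2).1) : ℝ)|
  have hP : ((Finset.univ.filter P).card : ℝ) ≤ Real.exp (-(2*s)) * K^2 := by
    have e1 : (Finset.univ.filter P).card ≤ bcount N (j+1) (8/10*r) := by
      rw [← bcount_pairs]
      apply Finset.card_le_card_of_injOn (fun p => ((p 0).1, (p 1).1))
      · intro p hp
        simp only [Finset.coe_filter, Finset.mem_univ, true_and, Set.mem_setOf_eq] at hp ⊢
        exact hp
      · intro p _ q _ h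
        simp only [Prod.mk.injEq] at h
        ext t : 1
        fin_cases t
        · exact Subtype.ext h.1
        · exact Subtype.ext h.2
    calc ((Finset.univ.filter P).card : ℝ) ≤ bcount N (j+1) (8/10*r) := by exact_mod_cast e1
      _ ≤ Real.exp (-(4*s)) * Ω^2 := h2
      _ ≤ Real.exp (-(4*s)) * (Real.exp s * K)^2 := by gcongr
      _ = _ := by
        rw [mul_pow, ← mul_assoc, ← Real.exp_nat_mul, ← Real.exp_add]
        congr 2; push_cast; ring
  have htail : ∀ v, ((Finset.univ.filter (fun ω : Fin m → KK j => r/10 < |(inner ℝ (g v) (XX j ω) : ℝ)|)).card : ℝ)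
      ≤ 2 * Real.exp (-(4*s)) * K := by
    intro v
    have t1 := XX_tail j (g v) (hg1 v) (r/10) (by positivity)
    have t2 := XX_tail j (-(g v)) (by rw [norm_neg]; exact hg1 v) (r/10) (by positivity)
    have t3 : (Finset.univ.filter (fun ω : Fin m → KK j => r/10 < |(inner ℝ (g v) (XX j ω) : ℝ)|)).card ≤
      (Finset.univ.filter (fun ω : Fin m → KK j => r/10 < (inner ℝ (g v) (XX j ω) : ℝ))).card +
      (Finset.univ.filter (fun ω : Fin m → KK j => r/10 < (inner ℝ (-(g v)) (XX j ω) : ℝ))).card := by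
      refine le_trans (Finset.card_le_card ?_) (Finset.card_union_le _ _)
      intro ω hω
      simp only [Finset.mem_union, Finset.mem_filter, Finset.mem_univ, true_and, inner_neg_left] at hω ⊢
      exact lt_abs.1 hω
    have t4 : Real.exp (-((r/10)^2/2)) ≤ Real.exp (-(5*s)) := Real.exp_le_exp.2 (by linarith)
    have t5 : ((Finset.univ.filter (fun ω : Fin m → KK j => r/10 < |(inner ℝ (g v) (XX j ω) : ℝ)|)).card : ℝ)
      ≤ Ω * Real.exp (-((r/10)^2/2)) + Ω * Real.exp (-((r/10)^2/2)) := by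
      refine le_trans (by exact_mod_cast t3) (add_le_add t1 t2)
    calc _ ≤ _ := t5
      _ = 2 * (Ω * Real.exp (-((r/10)^2/2))) := by ring
      _ ≤ 2 * ((Real.exp s * K) * Real.exp (-(5*s))) := by gcongr
      _ = 2 * (Real.exp s * Real.exp (-(5*s))) * K := by ring
      _ = _ := by rw [← Real.exp_add]; congr 3; ring
  have hQ : ((Finset.univ.filter Q).card : ℝ) ≤ (2 * Real.exp (-(4*s))) * K^3 := by
    rw [Finset.card_eq_sum_card_fiberwise (f := fun p : Fin 3 → A => (p 0, p 1)) (t := Finset.univ)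
      (by intro x _; simp)]
    push_cast
    calc _ ≤ ∑ b : A × A, 2 * Real.exp (-(4*s)) * K := by
          apply Finset.sum_le_sum
          intro b _
          refine le_trans ?_ (htail (XX j b.1.1 - XX j b.2.1))
          norm_cast
          apply Finset.card_le_card_of_injOn (fun p => (p 2).1)
          · intro p hp
            simp only [Finset.coe_filter, Finset.mem_filter, Finset.mem_univ, true_and, Set.mem_setOf_eq] at hp ⊢
            obtain ⟨hp1, hp2⟩ := hp
            rw [← hp2]
            exact hp1
          · intro p hp q hq h
            simp only [Finset.coe_filter, Finset.mem_filter, Finset.mem_univ, true_and, Set.mem_setOf_eq] at hp hq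
            have hpq := hp.2.trans hq.2.symm
            simp only [Prod.mk.injEq] at hpq
            ext t : 1
            fin_cases t
            · exact hpq.1
            · exact hpq.2
            · exact Subtype.ext h
      _ = _ := by
        rw [Finset.sum_const, nsmul_eq_mul, Finset.card_univ, Fintype.card_prod]
        push_cast
        rw [← hK]; ring
  obtain ⟨x, hx1, hx2⟩ := tuple_exists P Q M (Real.exp (-(2*s))) (2 * Real.exp (-(4*s))) hP hQ (by
    have a1 : (M:ℝ)^2 ≤ Real.exp s := by
      calc (M:ℝ)^2 ≤ (Real.exp (s/2))^2 := by gcongr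
        _ = _ := by rw [← Real.exp_nat_mul]; congr 1; push_cast; ring
    have a2 : (M:ℝ)^3 ≤ Real.exp (2*s) := by
      calc (M:ℝ)^3 ≤ (Real.exp (s/2))^3 := by gcongr
        _ = Real.exp (3 * s/2) := by rw [← Real.exp_nat_mul]; congr 1; push_cast; ring
        _ ≤ _ := Real.exp_le_exp.2 (by linarith)
    have a3 : Real.exp s * Real.exp (-(2*s)) = (Real.exp s)⁻¹ := by
      rw [← Real.exp_neg, ← Real.exp_add]; congr 1; ring
    have a4 : Real.exp (2*s) * Real.exp (-(4*s)) = (Real.exp (2*s))⁻¹ := by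
      rw [← Real.exp_neg, ← Real.exp_add]; congr 1; ring
    have a5 : (Real.exp s)⁻¹ ≤ 3⁻¹ := by
      have := Real.add_one_le_exp s
      gcongr; linarith
    have a6 : (Real.exp (2*s))⁻¹ ≤ 5⁻¹ := by
      have := Real.add_one_le_exp (2*s)
      gcongr; linarith
    have b1 : (M:ℝ)^2 * Real.exp (-(2*s)) ≤ 3⁻¹ := by
      refine le_trans (by gcongr) (a3.le.trans a5)
    have b2 : (M:ℝ)^3 * Real.exp (-(4*s)) ≤ 5⁻¹ := by
      refine le_trans (by gcongr) (a4.le.trans a6)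
    have b3 : (M:ℝ)^3 * (2 * Real.exp (-(4*s))) = 2 * ((M:ℝ)^3 * Real.exp (-(4*s))) := by ring
    rw [b3]
    norm_num at b1 b2
    linarith)
  have hsqrt : 1.131 < √2 * (8/10) := by
    have : (1.414:ℝ) < √2 := by
      rw [Real.lt_sqrt (by norm_num)]; norm_num
    linarith
  set c : ℝ := 1 / (1.01 * r) with hc
  have hc0 : 0 < c := by positivity
  have hcr : c * r * 1.01 = 1 := by rw [hc]; field_simp
  refine ⟨fun i => c • XX j (x i).1, fun i => ?_, fun i k hik => ?_⟩
  · have := (x i).2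
    rw [map_smul_eq_mul, Real.norm_eq_abs, abs_of_pos hc0]
    have : c * N (XX j (x i).1) ≤ c * r := by gcongr
    nlinarith
  · set v := XX j (x i).1 - XX j (x k).1 with hv
    have p1 : √2 * (8/10 * r) < N v := by
      have := hx1 i k hik
      exact not_le.1 this
    have p2 : ∀ l, l ≠ i → l ≠ k → |(inner ℝ (g v) (XX j (x l).1) : ℝ)| ≤ r/10 := by
      intro l hl1 hl2
      have := hx2 i k l hik hl1 hl2
      exact not_lt.1 this
    have p3 : ∀ l, (inner ℝ (g v) (XX j (x l).1) : ℝ) ≤ r := fun l => (hg2 v _).trans (x l).2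
    have p4 : ∀ l, -r ≤ (inner ℝ (g v) (XX j (x l).1) : ℝ) := by
      intro l
      have := hg2 v (-(XX j (x l).1))
      rw [inner_neg_right, map_neg_eq_map] at this
      have := (x l).2
      linarith
    have p5 : (inner ℝ (g v) (XX j (x i).1) : ℝ) - inner ℝ (g v) (XX j (x k).1) = N v := by
      rw [← hg3 v, ← inner_sub_right]
    have p6 : 1.131 * r < N v := by nlinarith
    refine ⟨(innerSL ℝ (g v)).toLinearMap, fun u => by simpa using hg2 v u, ?_, fun l => ?_⟩
    · simp only [ContinuousLinearMap.coe_coe, innerSL_apply_apply, real_inner_smul_right]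
      nlinarith
    · simp only [ContinuousLinearMap.coe_coe, innerSL_apply_apply, real_inner_smul_right]
      have q1 := p3 i
      have q2 := p4 k
      have q : (inner ℝ (g v) (XX j (x k).1) : ℝ) ≤ inner ℝ (g v) (XX j (x l).1) ∧
          (inner ℝ (g v) (XX j (x l).1) : ℝ) ≤ inner ℝ (g v) (XX j (x i).1) := by
        by_cases hl1 : l = i
        · subst hl1; constructor <;> linarith
        by_cases hl2 : l = k
        · subst hl2; constructor <;> linarith
        have := abs_le.1 (p2 l hl1 hl2)
        constructor <;> linarith
      constructor
      · exact mul_le_mul_of_nonneg_left q.1 hc0.le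
      · exact mul_le_mul_of_nonneg_left q.2 hc0.le

/-- final stage -/
lemma final_stage (D : ℝ) (hD : 0 < D) : ∃ a : ℝ, 0 < a ∧ ∃ m0 : ℕ, ∀ m, m0 ≤ m →
    ∀ N : Seminorm ℝ (VV m), (∀ u, N u ≤ ‖u‖) → (∀ u, ‖u‖ ≤ D * N u) →
    ∀ M : ℕ, (M:ℝ) ≤ Real.exp (a * m / 2) → HasAnt N M := by
  obtain ⟨J, hJ⟩ := exists_pow_lt_of_lt_one (show 0 < 1/(2*D) by positivity) (show (8/10:ℝ) < 1 by norm_num)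
  set a : ℝ := (64/100)^J / 1000 / 4^J with ha
  have ha0 : 0 < a := by positivity
  have h64 : ((64/100:ℝ))^J ≤ 1 := pow_le_one₀ (by norm_num) (by norm_num)
  have haJ : 4^J * a = (64/100)^J / 1000 := by rw [ha]; field_simp
  refine ⟨a, ha0, ⌈2/a⌉₊ + 1, fun m hm N hN1 hN2 M hM => ?_⟩
  have hm1 : 2/a ≤ m := by
    have h1 := Nat.le_ceil (2/a)
    have h2 : ((⌈2/a⌉₊ + 1 : ℕ) : ℝ) ≤ m := by exact_mod_cast hm
    push_cast at h2
    linarith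
  have hm2 : 2 ≤ a * m := by rw [div_le_iff₀ ha0] at hm1; linarith
  have hm0 : (0:ℝ) < m := lt_of_lt_of_le (by positivity) hm1
  have hsm : 0 < √(m:ℝ) := Real.sqrt_pos.2 hm0
  have hsq : √(m:ℝ)^2 = m := Real.sq_sqrt hm0.le
  let G : ℕ → Prop := fun j => Real.exp (-(4^j * a * m)) * Fintype.card (Fin m → KK j) ≤
    bcount N j ((8/10)^j * √m)
  have hG0 : G 0 := by
    have e : bcount N 0 ((8/10)^0 * √m) = Fintype.card (Fin m → KK 0) := by
      unfold bcount
      rw [Finset.filter_true_of_mem, Finset.card_univ]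
      intro ω _
      have := hN1 (XX 0 ω)
      rw [XX_zero_norm] at this
      simpa using this
    change _ ≤ ((bcount N 0 ((8/10)^0 * √m) : ℕ) : ℝ)
    rw [e]
    have : Real.exp (-(4^0 * a * m)) ≤ 1 := Real.exp_le_one_iff.2 (by
      have : 0 < a * m := by positivity
      simp; linarith)
    have h : (0:ℝ) ≤ Fintype.card (Fin m → KK 0) := by positivity
    nlinarith
  have hGJ : ¬ G J := by
    intro hG
    have h1 : bcount N J ((8/10)^J * √m) ≤ (Finset.univ.filter (fun ω : Fin m → KK J => ‖XX J ω‖^2 ≤ m/4)).card := by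
      unfold bcount
      apply Finset.card_le_card
      intro ω hω
      simp only [Finset.mem_filter, Finset.mem_univ, true_and] at hω ⊢
      have h2 : ‖XX J ω‖ ≤ √m / 2 := by
        calc ‖XX J ω‖ ≤ D * N (XX J ω) := hN2 _
          _ ≤ D * ((8/10)^J * √m) := by gcongr
          _ ≤ D * (1/(2*D) * √m) := by gcongr
          _ = _ := by field_simp
      calc ‖XX J ω‖^2 ≤ (√m/2)^2 := by gcongr
        _ = _ := by rw [div_pow, hsq]; norm_num
    have h2 : Real.exp (-(4^J * a * m)) * Fintype.card (Fin m → KK J) ≤ Fintype.card (Fin m → KK J) * (9/10)^m :=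
      hG.trans ((by exact_mod_cast h1 : ((bcount N J ((8/10)^J * √m) : ℕ) : ℝ) ≤ _).trans (XX_small J))
    have h3 : (0:ℝ) < Fintype.card (Fin m → KK J) := by exact_mod_cast Fintype.card_pos
    have h4 : Real.exp (-(4^J * a * m)) ≤ (9/10)^m := by
      rw [mul_comm] at h2
      exact le_of_mul_le_mul_left h2 h3
    have h5 : Real.exp (-(4^J * a * m)) = (Real.exp (-(4^J * a)))^m := by
      rw [← Real.exp_nat_mul]; congr 1; ring
    rw [h5] at h4
    have h6 : (9/10:ℝ) < Real.exp (-(4^J * a)) := by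
      have := Real.add_one_le_exp (-(4^J * a))
      rw [haJ] at *
      linarith
    have h7 : (9/10:ℝ)^m < (Real.exp (-(4^J * a)))^m := by
      apply pow_lt_pow_left₀ h6 (by norm_num)
      intro h
      rw [h] at hm0
      simp at hm0
    linarith
  obtain ⟨j, hjJ, hj1, hj2⟩ : ∃ j, j < J ∧ G j ∧ ¬ G (j+1) := by
    by_contra hc
    push Not at hc
    have : ∀ j, j ≤ J → G j := by
      intro j
      induction j with
      | zero => intro _; exact hG0
      | succ j ih => intro h; exact hc j (by omega) (ih (by omega))
    exact hGJ (this J le_rfl)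
  have hcard : (Fintype.card (Fin m → KK (j+1)) : ℝ) = (Fintype.card (Fin m → KK j) : ℝ)^2 := by
    simp only [Fintype.card_pi, Finset.prod_const, KK_card_succ]
    push_cast
    simp only [Finset.card_univ, Fintype.card_fin]
    ring
  have h4j : (1:ℝ) ≤ 4^j := one_le_pow₀ (by norm_num)
  refine level (j := j) N hN1 ((8/10)^j * √m) (4^j * a * m) (by positivity) M hj1 ?_ ?_ ?_ ?_
  · have h1 := (not_le.1 hj2).le
    rw [hcard] at h1
    have e1 : (8/10:ℝ) * ((8/10)^j * √m) = (8/10)^(j+1) * √m := by rw [pow_succ]; ring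
    have e2 : 4 * (4^j * a * m) = 4^(j+1) * a * m := by rw [pow_succ]; ring
    rw [e1, e2]
    exact h1
  · have e1 : ((8/10:ℝ)^j * √m / 10)^2/2 = (64/100)^j * m / 200 := by
      rw [div_pow, mul_pow, hsq, ← pow_mul, mul_comm j 2, pow_mul]; norm_num; ring
    rw [e1]
    have e2 : (64/100:ℝ)^J ≤ (64/100)^j := pow_le_pow_of_le_one (by norm_num) (by norm_num) hjJ.le
    have e3 : (4:ℝ)^j * a ≤ 4^J * a := by gcongr; norm_num
    rw [haJ] at e3
    have e4 : 4^j * a * m ≤ ((64/100)^j / 1000) * m := by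
      gcongr; linarith
    linarith
  · nlinarith
  · refine hM.trans (Real.exp_le_exp.2 ?_)
    nlinarith

end PJ

lemma all_ant : ∃ a : ℝ, 0 < a ∧ ∃ n1 : ℕ, ∀ n, n1 ≤ n → ∀ (N : Seminorm ℝ (VV n)) (C : ℝ),
    (∀ u, ‖u‖ ≤ C * N u) → ∀ M : ℕ, (M:ℝ) ≤ Real.exp (a * n / 4) → HasAnt N M := by
  obtain ⟨B, hB⟩ : ∃ B : ℕ, 327 ≤ B := ⟨327, le_rfl⟩
  obtain ⟨a, ha, m0, h⟩ := final_stage (2 ^ (3 * B)) (by positivity)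
  refine ⟨a, ha, 2 * m0 + 8, fun n hn N C hC M hM => ?_⟩
  refine start B hB n M (by omega) ?_ N C hC
  intro m _ hm2 N' hN1 hN2
  refine h m (by omega) N' hN1 hN2 M (hM.trans (Real.exp_le_exp.2 ?_))
  have : (n:ℝ) ≤ 2 * m := by exact_mod_cast hm2
  nlinarith

lemma sphere_ant {X : Type*} [NormedAddCommGroup X] [NormedSpace ℝ X] [FiniteDimensional ℝ X] (n M : ℕ)
    (hn : Module.finrank ℝ X = n + 1)
    (h : ∀ (N : Seminorm ℝ (VV n)) (C : ℝ), (∀ u, ‖u‖ ≤ C * N u) → HasAnt N M) :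
    ∃ p : Fin M → X, (∀ i, ‖p i‖ = 1) ∧ ∀ i j, i ≠ j → ∃ f : X →L[ℝ] ℝ, ‖f‖ ≤ 1 ∧
      1 < f (p i) - f (p j) ∧ ∀ l, f (p j) ≤ f (p l) ∧ f (p l) ≤ f (p i) := by
  haveI : Nontrivial X := Module.nontrivial_of_finrank_pos (R := ℝ) (by omega)
  obtain ⟨w, hw⟩ := exists_norm_eq X (zero_le_one' ℝ)
  have hw0 : w ≠ 0 := by
    intro h0; rw [h0, norm_zero] at hw; norm_num at hw
  let S : Submodule ℝ X := Submodule.span ℝ {w}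
  haveI hcl : IsClosed (S : Set X) := S.closed_of_finiteDimensional
  have hfr : Module.finrank ℝ (X ⧸ S) = n := by
    have h1 := Submodule.finrank_quotient_add_finrank S
    have h2 : Module.finrank ℝ S = 1 := finrank_span_singleton hw0
    omega
  let e : VV n ≃ₗ[ℝ] (X ⧸ S) := LinearEquiv.ofFinrankEq _ _ (by rw [hfr]; simp)
  let ec : VV n ≃L[ℝ] (X ⧸ S) := e.toContinuousLinearEquiv
  have hC : ∀ u, ‖u‖ ≤ ‖(ec.symm : (X ⧸ S) →L[ℝ] VV n)‖ * ((normSeminorm ℝ (X ⧸ S)).comp e.toLinearMap) u := by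
    intro u
    have := (ec.symm : (X ⧸ S) →L[ℝ] VV n).le_opNorm (ec u)
    have e1 : (ec.symm : (X ⧸ S) →L[ℝ] VV n) (ec u) = u := ec.symm_apply_apply u
    rw [e1] at this
    exact this
  obtain ⟨x, hx, hf⟩ := h _ _ hC
  have hlift : ∀ i, ∃ p : X, ‖p‖ = 1 ∧ S.mkQ p = e (x i) := by
    intro i
    have hxi : ‖e (x i)‖ < 1 := hx i
    obtain ⟨z, hz1, hz2⟩ : ∃ z : X, S.mkQ z = e (x i) ∧ ‖z‖ < 1 := by
      obtain ⟨z, hz1, hz2⟩ := Submodule.Quotient.norm_mk_lt (e (x i)) (sub_pos.2 hxi)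
      exact ⟨z, hz1, by linarith⟩
    have hc : Continuous (fun t : ℝ => ‖z + t • w‖) := by fun_prop
    have h1 : (1:ℝ) ∈ Set.Icc (‖z + (0:ℝ) • w‖) (‖z + (2:ℝ) • w‖) := by
      constructor
      · simpa using hz2.le
      · have := norm_sub_le (z + (2:ℝ) • w) z
        rw [add_sub_cancel_left, norm_smul, hw] at this
        norm_num at this
        linarith
    obtain ⟨t, -, ht⟩ := intermediate_value_Icc (by norm_num : (0:ℝ) ≤ 2) hc.continuousOn h1
    refine ⟨z + t • w, ht, ?_⟩
    have : S.mkQ w = 0 := by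
      rw [Submodule.mkQ_apply, Submodule.Quotient.mk_eq_zero]
      exact Submodule.mem_span_singleton_self w
    rw [map_add, map_smul, this, smul_zero, add_zero, hz1]
  choose p hp1 hp2 using hlift
  refine ⟨p, hp1, fun i j hij => ?_⟩
  obtain ⟨f, hf1, hf2, hf3⟩ := hf i j hij
  let F : X →ₗ[ℝ] ℝ := f ∘ₗ e.symm.toLinearMap ∘ₗ S.mkQ
  have hF1 : ∀ v, F v ≤ ‖v‖ := by
    intro v
    have h1 : F v ≤ ‖e (e.symm (S.mkQ v))‖ := hf1 _
    rw [LinearEquiv.apply_symm_apply] at h1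
    exact h1.trans (Submodule.Quotient.norm_mk_le S v)
  have hF2 : ∀ l, F (p l) = f (x l) := by
    intro l
    change f (e.symm (S.mkQ (p l))) = _
    rw [hp2, LinearEquiv.symm_apply_apply]
  refine ⟨F.mkContinuous 1 ?_, LinearMap.mkContinuous_norm_le _ zero_le_one _, ?_, ?_⟩
  · intro v
    rw [one_mul, Real.norm_eq_abs, abs_le]
    refine ⟨?_, hF1 v⟩
    have := hF1 (-v)
    rw [map_neg, norm_neg] at this
    linarith
  · simp only [LinearMap.mkContinuous_apply, hF2]
    exact hf2
  · intro l
    simp only [LinearMap.mkContinuous_apply, hF2]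
    exact hf3 l

lemma strict_bdd (X : Type*) [NormedAddCommGroup X] [NormedSpace ℝ X] [FiniteDimensional ℝ X] :
    BddAbove {k : ℕ | ∃ S : Finset X, S.card = k ∧ (S : Set X) ⊆ sphere (0 : X) 1 ∧
      StrictAntipProp (S : Set X)} := by
  classical
  haveI : ProperSpace X := FiniteDimensional.proper ℝ X
  obtain ⟨t, -, htf, hcov⟩ := (isCompact_sphere (0:X) 1).finite_cover_balls (e := 1/2) (by norm_num)
  refine ⟨htf.toFinset.card, ?_⟩
  rintro k ⟨S, rfl, hS, hA⟩
  have h1 : ∀ x ∈ S, ∃ y ∈ t, x ∈ ball y (1/2) := by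
    intro x hx
    simpa using hcov (hS hx)
  choose! c hc1 hc2 using h1
  apply Finset.card_le_card_of_injOn c
  · intro x hx
    simpa using hc1 x hx
  · intro x hx y hy hxy
    by_contra hne
    obtain ⟨f, hf1, hf2, -⟩ := hA x hx y hy hne
    have h2 : f x - f y ≤ ‖x - y‖ := by
      rw [← map_sub]
      refine (le_abs_self _).trans ?_
      have := f.le_of_opNorm_le hf1 (x - y)
      simpa using this
    have h3 := hc2 x hx
    have h4 := hc2 y hy
    rw [← hxy] at h4
    rw [mem_ball] at h3 h4
    have h5 := dist_triangle_right x y (c x)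
    rw [dist_eq_norm x y] at h5
    linarith

theorem strictHalpha_exponential_growth :
    ∃ c : ℝ, 1 < c ∧ ∃ n₀ : ℕ, ∀ n : ℕ, n₀ ≤ n →
      ∀ (X : Type) [NormedAddCommGroup X] [NormedSpace ℝ X] [FiniteDimensional ℝ X],
        Module.finrank ℝ X = n →
        c ^ n ≤ (strictHalpha X : ℝ) ∧
        ∃ S : Finset X, c ^ n ≤ (S.card : ℝ) ∧ (S : Set X) ⊆ sphere (0 : X) 1 ∧
          ∃ d : ℝ, 1 < d ∧ IsBSA (S : Set X) d := by
  obtain ⟨a, ha, n1, hall⟩ := all_ant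
  refine ⟨Real.exp (a/16), Real.one_lt_exp_iff.2 (by positivity), n1 + ⌈8/a⌉₊ + 2, ?_⟩
  intro n hn X _ _ _ hX
  classical
  obtain ⟨k, rfl⟩ : ∃ k, n = k + 1 := ⟨n - 1, by omega⟩
  set M := ⌊Real.exp (a * k / 4)⌋₊ with hM
  have hM1 : (M:ℝ) ≤ Real.exp (a * k / 4) := Nat.floor_le (Real.exp_pos _).le
  have hM2 : Real.exp (a * k / 4) < M + 1 := Nat.lt_floor_add_one _
  have hk8 : 8 / a ≤ k := by
    have h1 := Nat.le_ceil (8/a)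
    have h2 : ⌈8/a⌉₊ ≤ k := by omega
    have h3 : (⌈8/a⌉₊ : ℝ) ≤ k := by exact_mod_cast h2
    linarith
  have hk : 8 ≤ a * k := by rw [div_le_iff₀ ha] at hk8; linarith
  have hk1 : (1:ℝ) ≤ k := by
    have : 1 ≤ k := by omega
    exact_mod_cast this
  have hcn : Real.exp (a/16) ^ (k+1) ≤ M := by
    have h1 : Real.exp (a/16) ^ (k+1) ≤ Real.exp (a * k / 8) := by
      rw [← Real.exp_nat_mul]
      apply Real.exp_le_exp.2
      push_cast
      nlinarith
    have h2 : Real.exp (a * k / 4) = Real.exp (a * k / 8) * Real.exp (a * k / 8) := by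
      rw [← Real.exp_add]; congr 1; ring
    have h3 : 2 ≤ Real.exp (a * k / 8) := by
      have := Real.add_one_le_exp (a * k / 8)
      linarith
    nlinarith
  obtain ⟨p, hp1, hp2⟩ := sphere_ant (X := X) k M hX
    (fun N C hC => hall k (by omega) N C hC M hM1)
  choose! f hf1 hf2 hf3 using hp2
  have hinj : Function.Injective p := by
    intro i j hij
    by_contra hne
    have := hf2 i j hne
    rw [hij, sub_self] at this
    norm_num at this
  obtain ⟨d, hd1, hd2⟩ : ∃ d : ℝ, 1 < d ∧ ∀ i j, i ≠ j → d ≤ f i j (p i) - f i j (p j) := by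
    let g : Fin M × Fin M → ℝ := fun q => if q.1 = q.2 then 2 else f q.1 q.2 (p q.1) - f q.1 q.2 (p q.2)
    have hg : ∀ q, 1 < g q := by
      intro q
      by_cases h : q.1 = q.2
      · simp [g, h]
      · simpa [g, h] using hf2 q.1 q.2 h
    rcases isEmpty_or_nonempty (Fin M × Fin M) with he | he
    · exact ⟨2, by norm_num, fun i j _ => (he.false (i, j)).elim⟩
    · obtain ⟨q0, hq0⟩ := Finite.exists_min g
      refine ⟨g q0, hg q0, fun i j hij => ?_⟩
      simpa [g, hij] using hq0 (i, j)
  set S : Finset X := Finset.univ.image p with hS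
  have hcard : S.card = M := by
    rw [hS, Finset.card_image_of_injective _ hinj]; simp
  have hSs : (S : Set X) ⊆ sphere (0 : X) 1 := by
    intro x hx
    rw [hS, Finset.mem_coe, Finset.mem_image] at hx
    obtain ⟨i, -, rfl⟩ := hx
    rw [mem_sphere_zero_iff_norm]
    exact hp1 i
  have hBSA : IsBSA (S : Set X) d := by
    refine ⟨hSs.trans sphere_subset_closedBall, ?_⟩
    intro x hx y hy hxy
    rw [hS, Finset.mem_coe, Finset.mem_image] at hx hy
    obtain ⟨i, -, rfl⟩ := hx
    obtain ⟨j, -, rfl⟩ := hy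
    have hij : i ≠ j := fun h => hxy (by rw [h])
    refine ⟨f i j, hf1 i j hij, hd2 i j hij, ?_⟩
    intro z hz
    rw [hS, Finset.mem_coe, Finset.mem_image] at hz
    obtain ⟨l, -, rfl⟩ := hz
    exact hf3 i j hij l
  have hstrict : StrictAntipProp (S : Set X) := by
    intro x hx y hy hxy
    obtain ⟨g, hg1, hg2, hg3⟩ := hBSA.2 x hx y hy hxy
    exact ⟨g, hg1, lt_of_lt_of_le hd1 hg2, hg3⟩
  refine ⟨?_, S, by rw [hcard]; exact hcn, hSs, d, hd1, hBSA⟩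
  have h1 : M ≤ strictHalpha X := le_csSup (strict_bdd X) ⟨S, hcard, hSs, hstrict⟩
  exact hcn.trans (by exact_mod_cast h1)

end
end

section
/- Let X be a two-dimensional real normed space (a Minkowski plane) and suppose there exist x, y on the unit sphere of X with ‖x − y‖ = ‖x + y‖ = 1. Then X is isometrically isomorphic to ℓ_∞²; equivalently, the unit ball of X is the parallelogram with vertices ±(x + y) and ±(x − y). -/
open Metric

noncomputable section

/-- If `u, w` are unit vectors with `‖u + w‖ = ‖u - w‖ = 2`, they span an `ℓ₁` norm. -/
lemma norm_comb_aux {X : Type*} [NormedAddCommGroup X] [NormedSpace ℝ X] (u w : X)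
    (hu : ‖u‖ = 1) (hw : ‖w‖ = 1) (hp : ‖u + w‖ = 2) (a b : ℝ) (ha : 0 ≤ a) (hb : 0 ≤ b) :
    a + b ≤ ‖a • u + b • w‖ := by
  rcases le_total b a with h | h
  · have h1 : a • (u + w) = (a • u + b • w) + (a - b) • w := by module
    have h2 := norm_add_le (a • u + b • w) ((a - b) • w)
    rw [← h1, norm_smul, norm_smul, hp, hw, Real.norm_of_nonneg ha,
      Real.norm_of_nonneg (sub_nonneg.2 h)] at h2
    linarith
  · have h1 : b • (u + w) = (a • u + b • w) + (b - a) • u := by module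
    have h2 := norm_add_le (a • u + b • w) ((b - a) • u)
    rw [← h1, norm_smul, norm_smul, hp, hu, Real.norm_of_nonneg hb,
      Real.norm_of_nonneg (sub_nonneg.2 h)] at h2
    linarith

lemma norm_comb {X : Type*} [NormedAddCommGroup X] [NormedSpace ℝ X] (u w : X)
    (hu : ‖u‖ = 1) (hw : ‖w‖ = 1) (hp : ‖u + w‖ = 2) (hm : ‖u - w‖ = 2) (a b : ℝ) :
    ‖a • u + b • w‖ = |a| + |b| := by
  apply le_antisymm
  · have := norm_add_le (a • u) (b • w)
    rwa [norm_smul, norm_smul, hu, hw, mul_one, mul_one, Real.norm_eq_abs,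
      Real.norm_eq_abs] at this
  · rcases le_total 0 a with ha | ha <;> rcases le_total 0 b with hb | hb
    · rw [abs_of_nonneg ha, abs_of_nonneg hb]
      exact norm_comb_aux u w hu hw hp a b ha hb
    · rw [abs_of_nonneg ha, abs_of_nonpos hb]
      have := norm_comb_aux u (-w) hu (by rwa [norm_neg]) (by rwa [← sub_eq_add_neg]) a (-b)
        ha (by linarith)
      rwa [neg_smul_neg] at this
    · rw [abs_of_nonpos ha, abs_of_nonneg hb]
      have := norm_comb_aux u (-w) hu (by rwa [norm_neg]) (by rwa [← sub_eq_add_neg]) (-a) b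
        (by linarith) hb
      have h : -a • u + b • -w = -(a • u + b • w) := by module
      rwa [h, norm_neg] at this
    · rw [abs_of_nonpos ha, abs_of_nonpos hb]
      have := norm_comb_aux u w hu hw hp (-a) (-b) (by linarith) (by linarith)
      have h : -a • u + -b • w = -(a • u + b • w) := by module
      rwa [h, norm_neg] at this

/-- Let `X` be a Minkowski plane (two-dimensional real normed space)
containing unit vectors `x, y` with `‖x − y‖ = ‖x + y‖ = 1`. Then `X` is isometrically
isomorphic to `ℓ_∞²` (here `Fin 2 → ℝ` with the sup norm); equivalently, the closed unit
ball of `X` is the parallelogram with vertices `±(x + y)` and `±(x − y)`. -/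
theorem isometric_linf_two_of_norm_add_sub_eq_one (X : Type*) [NormedAddCommGroup X]
    [NormedSpace ℝ X] [FiniteDimensional ℝ X] (hdim : Module.finrank ℝ X = 2)
    (x y : X) (hx : ‖x‖ = 1) (hy : ‖y‖ = 1)
    (hsub : ‖x - y‖ = 1) (hadd : ‖x + y‖ = 1) :
    (∃ e : X ≃ₗ[ℝ] (Fin 2 → ℝ), ∀ v : X, ‖e v‖ = ‖v‖) ∧
    closedBall (0 : X) 1 =
      convexHull ℝ ({x + y, -(x + y), x - y, -(x - y)} : Set X) := by
  have key : ∀ a b : ℝ, ‖a • (x + y) + b • (x - y)‖ = |a| + |b| := by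
    apply norm_comb _ _ hadd hsub
    · rw [show x + y + (x - y) = (2 : ℝ) • x by module, norm_smul, hx]; norm_num
    · rw [show x + y - (x - y) = (2 : ℝ) • y by module, norm_smul, hy]; norm_num
  let f : (Fin 2 → ℝ) →ₗ[ℝ] X :=
    { toFun := fun p => p 0 • x + p 1 • y
      map_add' := fun p q => by simp only [Pi.add_apply]; module
      map_smul' := fun c p => by
        simp only [Pi.smul_apply, smul_eq_mul, RingHom.id_apply]; module }
  have hf' : ∀ p, f p = ((p 0 + p 1) / 2) • (x + y) + ((p 0 - p 1) / 2) • (x - y) := by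
    intro p
    change p 0 • x + p 1 • y = _
    module
  have hf : ∀ p, ‖f p‖ = ‖p‖ := by
    intro p
    rw [hf', key]
    have h0 := norm_le_pi_norm p 0
    have h1 := norm_le_pi_norm p 1
    rw [Real.norm_eq_abs] at h0 h1
    apply le_antisymm
    · rw [abs_le] at h0 h1
      rcases abs_cases ((p 0 + p 1) / 2) with h | h <;>
        rcases abs_cases ((p 0 - p 1) / 2) with h' | h' <;> linarith
    · rw [pi_norm_le_iff_of_nonneg (by positivity)]
      intro i
      rw [Real.norm_eq_abs]
      fin_cases i
      · have := abs_add_le ((p 0 + p 1) / 2) ((p 0 - p 1) / 2)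
        ring_nf at this ⊢
        exact this
      · have := abs_sub ((p 0 + p 1) / 2) ((p 0 - p 1) / 2)
        ring_nf at this ⊢
        exact this
  have hinj : Function.Injective f := by
    rw [injective_iff_map_eq_zero]
    intro p hp
    rw [← norm_eq_zero, ← hf, hp, norm_zero]
  let e := LinearEquiv.ofInjectiveOfFinrankEq f hinj (by simp [hdim])
  have he : ∀ p, e p = f p := fun p => rfl
  refine ⟨⟨e.symm, fun v => ?_⟩, ?_⟩
  · rw [← hf, ← he, e.apply_symm_apply]
  apply Set.Subset.antisymm
  · intro v hv
    rw [mem_closedBall_zero_iff] at hv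
    obtain ⟨p, rfl⟩ := e.surjective v
    rw [he, hf'] at hv ⊢
    rw [key] at hv
    generalize (p 0 + p 1) / 2 = a at *
    generalize (p 0 - p 1) / 2 = b at *
    have hab := abs_le.1 (show |a| ≤ 1 - |b| by linarith)
    have h := (convex_convexHull ℝ ({x + y, -(x + y), x - y, -(x - y)} : Set X)).sum_mem
      (t := Finset.univ) (w := ![(1 - |b| + a) / 2, (1 - |b| - a) / 2, (|b| + b) / 2,
        (|b| - b) / 2]) (z := ![x + y, -(x + y), x - y, -(x - y)]) ?_ ?_ ?_
    · convert h using 1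
      simp only [Fin.sum_univ_four, Matrix.cons_val]
      module
    · intro i _
      have := neg_abs_le b
      have := le_abs_self b
      fin_cases i <;> simp only [Fin.reduceFinMk, Fin.zero_eta, Fin.mk_one, Matrix.cons_val] <;>
        linarith
    · simp only [Fin.sum_univ_four, Matrix.cons_val]
      ring
    · intro i _
      apply subset_convexHull
      fin_cases i <;> simp
  · apply convexHull_min _ (convex_closedBall 0 1)
    rintro v (rfl | rfl | rfl | rfl) <;> rw [mem_closedBall_zero_iff]
    · exact hadd.le
    · rw [norm_neg]; exact hadd.le
    · exact hsub.le
    · rw [norm_neg]; exact hsub.le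

end
end
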